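/- Let d ≥ 1, m ∈ ℝ, and 0 < p, q ≤ ∞. Suppose s ≤ τ_p := d/min(1,p) − d. Then there exists a symbol a ∈ S^m_{1,1} such that for every constant C > 0 there is a Schwartz function f with ‖T_a f‖_{B_p^{s,q}} > C ‖f‖_{B_p^{s+m,q}}; that is, the operator norm of T_a from B_p^{s+m,q} to B_p^{s,q} is infinite. -/

import Mathlib

noncomputable section

open MeasureTheory SchwartzMap Complex RealInnerProductSpace Filter
open scoped ENNReal NNReal ContDiff SchwartzMap

/-- Euclidean space `ℝ^d`. -/
abbrev RD (d : ℕ) : Type := EuclideanSpace ℝ (Fin d)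

/-- Tempered distributions on `ℝ^d`. -/
abbrev TD (d : ℕ) : Type := 𝓢(RD d, ℂ) →L[ℂ] ℂ

/-- Fourier transform of a Schwartz function (with the convention
`f̂(ξ) = ∫ f(x) e^{-2πi⟨x,ξ⟩} dx`). -/
def fourierS {d : ℕ} (f : 𝓢(RD d, ℂ)) : 𝓢(RD d, ℂ) :=
  SchwartzMap.fourierTransformCLM ℂ f

/-- Hörmander symbol class `S^m_{1,1}`: `a` is smooth and
`‖∂_ξ^α ∂_x^β a(x,ξ)‖ ≤ c_{α,β} (1+‖ξ‖)^{m-|α|+|β|}` for all orders of derivatives. -/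
def IsSymbolS11 (d : ℕ) (m : ℝ) (a : RD d → RD d → ℂ) : Prop :=
  ContDiff ℝ ∞ (fun p : RD d × RD d => a p.1 p.2) ∧
  ∀ α β : ℕ, ∃ c : ℝ, ∀ x ξ : RD d,
    ‖iteratedFDeriv ℝ α (fun ξ' => iteratedFDeriv ℝ β (fun x' => a x' ξ') x) ξ‖
      ≤ c * (1 + ‖ξ‖) ^ (m - (α : ℝ) + (β : ℝ))

/-- The pseudo-differential operator `T_a f(x) = ∫ a(x,ξ) f̂(ξ) e^{2πi⟨x,ξ⟩} dξ`
acting on a Schwartz function `f`. -/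
def pdo {d : ℕ} (a : RD d → RD d → ℂ) (f : 𝓢(RD d, ℂ)) (x : RD d) : ℂ :=
  ∫ ξ, a x ξ * fourierS f ξ * Complex.exp (2 * Real.pi * Complex.I * ((⟪x, ξ⟫ : ℝ) : ℂ))

/-- Littlewood–Paley data: a Schwartz function `φ` with `φ̂` supported in
`{1/2 ≤ |ξ| ≤ 2}` and `Σ_{k∈ℤ} φ̂(2^{-k}ξ) = 1` for `ξ ≠ 0`, together with the
low-frequency piece `Φ` determined by `Φ̂ = 1 - Σ_{k≥1} φ̂(2^{-k}·)`. -/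
structure LPData (d : ℕ) where
  φ : 𝓢(RD d, ℂ)
  Φ : 𝓢(RD d, ℂ)
  supp_φ : ∀ ξ : RD d, fourierS φ ξ ≠ 0 → 1/2 ≤ ‖ξ‖ ∧ ‖ξ‖ ≤ 2
  sum_φ : ∀ ξ : RD d, ξ ≠ 0 → HasSum (fun k : ℤ => fourierS φ ((2:ℝ)^(-k) • ξ)) 1
  Φ_def : ∀ ξ : RD d, fourierS Φ ξ = 1 - ∑' k : ℕ, fourierS φ (((2:ℝ)^(k+1))⁻¹ • ξ)

/-- The Littlewood–Paley convolution kernel: `Φ` for `k = 0` and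
`φ_k = 2^{kd} φ(2^k ·)` for `k ≥ 1`. -/
def LPkernel {d : ℕ} (D : LPData d) : ℕ → RD d → ℂ
  | 0, x => D.Φ x
  | (k+1), x => (((2:ℝ)^((k+1) * d) : ℝ) : ℂ) * D.φ ((2:ℝ)^(k+1) • x)

/-- The Fourier transform of the `k`-th Littlewood–Paley kernel, i.e. `φ̂_k = φ̂(2^{-k}·)`
for `k ≥ 1` and `Φ̂` for `k = 0`. -/
def LPhat {d : ℕ} (D : LPData d) : ℕ → RD d → ℂ
  | 0, ξ => fourierS D.Φ ξ
  | (k+1), ξ => fourierS D.φ (((2:ℝ)^(k+1))⁻¹ • ξ)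

/-- Littlewood–Paley operator `Π_k g = φ_k ∗ g` (with `φ_0 := Φ`) acting on functions. -/
def LP {d : ℕ} (D : LPData d) (k : ℕ) (g : RD d → ℂ) (x : RD d) : ℂ :=
  ∫ y, LPkernel D k y * g (x - y)

/-- `Π*_k = Π_{k-1} + Π_k + Π_{k+1}` (with the convention `φ_{-1} := 0`). -/
def LPstar {d : ℕ} (D : LPData d) (k : ℕ) (g : RD d → ℂ) (x : RD d) : ℂ :=
  (if k = 0 then 0 else LP D (k-1) g x) + LP D k g x + LP D (k+1) g x

open Classical in
/-- Pairing of a tempered distribution with a plain function: it gives `u ψ` if the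
function is (the coercion of) a Schwartz function `ψ`, and `0` otherwise. -/
def pairing {d : ℕ} (u : TD d) (g : RD d → ℂ) : ℂ :=
  if h : ∃ ψ : 𝓢(RD d, ℂ), ⇑ψ = g then u h.choose else 0

/-- Fourier transform of a tempered distribution, `⟨û, ψ⟩ = ⟨u, ψ̂⟩`. -/
def fourierTD {d : ℕ} (u : TD d) : TD d :=
  u.comp (SchwartzMap.fourierTransformCLM ℂ)

/-- Littlewood–Paley operator on tempered distributions:
`Π_k u (x) = ⟨u, φ_k(x - ·)⟩`. -/
def LPdist {d : ℕ} (D : LPData d) (k : ℕ) (u : TD d) (x : RD d) : ℂ :=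
  pairing u (fun y => LPkernel D k (x - y))

/-- The symbol `a_{j,k}(x,ξ) = (φ_j ∗ a(·,ξ))(x) · φ̂_k(ξ)` (with `Φ` replacing `φ_0`). -/
def symbolPiece {d : ℕ} (D : LPData d) (a : RD d → RD d → ℂ) (j k : ℕ)
    (x ξ : RD d) : ℂ :=
  (∫ y, LPkernel D j y * a (x - y) ξ) * LPhat D k ξ

/-- `T_{a_{j,k}} u (x) = ⟨û, a_{j,k}(x,·) e^{2πi⟨x,·⟩}⟩` for a tempered distribution `u`. -/
def pdoPieceD {d : ℕ} (D : LPData d) (a : RD d → RD d → ℂ) (j k : ℕ)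
    (u : TD d) (x : RD d) : ℂ :=
  pairing (fourierTD u)
    (fun ξ => symbolPiece D a j k x ξ * Complex.exp (2 * Real.pi * Complex.I * ((⟪x, ξ⟫ : ℝ) : ℂ)))

/-- Partial sums `Σ_{j=0}^N Σ_{k=0}^N T_{a_{j,k}} u (x)`. -/
def pdoPartial {d : ℕ} (D : LPData d) (a : RD d → RD d → ℂ) (N : ℕ)
    (u : TD d) (x : RD d) : ℂ :=
  ∑ j ∈ Finset.range (N+1), ∑ k ∈ Finset.range (N+1), pdoPieceD D a j k u x

/-- `T_a u` converges in `S'` to the tempered distribution `Tf`: the partial sums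
`Σ_{j,k≤N} T_{a_{j,k}} u` (which are functions) converge to `Tf` weakly. -/
def ConvergesInSPrime {d : ℕ} (D : LPData d) (a : RD d → RD d → ℂ)
    (u : TD d) (Tf : TD d) : Prop :=
  ∀ ψ : 𝓢(RD d, ℂ),
    Tendsto (fun N => ∫ x, pdoPartial D a N u x * ψ x) atTop (nhds (Tf ψ))

/-- The dyadic cube of level `ν` (side length `2^{-ν}`) indexed by `n ∈ ℤ^d`. -/
def dyadicCube (d : ℕ) (ν : ℤ) (n : Fin d → ℤ) : Set (RD d) :=
  {x | ∀ i, (n i : ℝ) * (2:ℝ)^(-ν) ≤ x i ∧ x i < ((n i : ℝ) + 1) * (2:ℝ)^(-ν)}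

/-- The local quantity `(|P|⁻¹ ∫_P Σ_{k=k₀}^∞ 2^{skq} ‖g_k(x)‖^q dx)^{1/q}` for the
dyadic cube `P` of level `μ` indexed by `n` (so that `|P|⁻¹ = 2^{μd}`). -/
def cubePiece (d : ℕ) (μ : ℕ) (n : Fin d → ℤ) (k₀ : ℕ) (s q : ℝ)
    (g : ℕ → RD d → ℂ) : ℝ≥0∞ :=
  ((2:ℝ≥0∞)^((μ:ℝ)*(d:ℝ)) *
    ∫⁻ x in dyadicCube d μ n,
      ∑' j : ℕ, (2:ℝ≥0∞)^(s*((k₀:ℝ)+(j:ℝ))*q) * (‖g (k₀+j) x‖₊ : ℝ≥0∞)^q) ^ (1/q)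

/-- The `F_∞^{s,q}` norm (for `q < ∞`) of a function, computed from its
Littlewood–Paley pieces:
`‖Π_0 g‖_∞ + sup_{l(P)<1 dyadic} (|P|⁻¹ ∫_P Σ_{k=-log₂ l(P)}^∞ 2^{skq}|Π_k g|^q)^{1/q}`. -/
def FinftyNormFun {d : ℕ} (D : LPData d) (s q : ℝ) (g : RD d → ℂ) : ℝ≥0∞ :=
  (⨆ x : RD d, (‖LP D 0 g x‖₊ : ℝ≥0∞)) +
  ⨆ (μ : ℕ) (_ : 1 ≤ μ) (n : Fin d → ℤ),
    cubePiece d μ n μ s q (fun k x => LP D k g x)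

/-- The `F_∞^{s,q}` norm (for `q < ∞`) of a tempered distribution. -/
def FinftyNormDist {d : ℕ} (D : LPData d) (s q : ℝ) (u : TD d) : ℝ≥0∞ :=
  (⨆ x : RD d, (‖LPdist D 0 u x‖₊ : ℝ≥0∞)) +
  ⨆ (μ : ℕ) (_ : 1 ≤ μ) (n : Fin d → ℤ),
    cubePiece d μ n μ s q (fun k x => LPdist D k u x)

/-- The (axis-parallel, closed) cube with corner `c` and side length `L`. -/
def cube (d : ℕ) (c : RD d) (L : ℝ) : Set (RD d) :=
  {x | ∀ i, c i ≤ x i ∧ x i ≤ c i + L}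

/-- The average of `g` over the cube with corner `c` and side length `L`. -/
def cubeMean {d : ℕ} (c : RD d) (L : ℝ) (g : RD d → ℂ) : ℂ :=
  (L^d)⁻¹ • ∫ x in cube d c L, g x

/-- The `bmo` norm (local BMO):
`sup_{l(Q)≥1} |Q|⁻¹∫_Q |g| + sup_{l(Q)<1} |Q|⁻¹∫_Q |g - g_Q|`, over all cubes `Q`. -/
def bmoNorm (d : ℕ) (g : RD d → ℂ) : ℝ≥0∞ :=
  (⨆ (c : RD d) (L : ℝ) (_ : 1 ≤ L),
    ENNReal.ofReal ((L^d)⁻¹) * ∫⁻ x in cube d c L, (‖g x‖₊ : ℝ≥0∞)) +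
  (⨆ (c : RD d) (L : ℝ) (_ : 0 < L) (_ : L < 1),
    ENNReal.ofReal ((L^d)⁻¹) * ∫⁻ x in cube d c L, (‖g x - cubeMean c L g‖₊ : ℝ≥0∞))

/-- The Peetre maximal function `𝔐_{σ,R} g(x) = sup_y ‖g(x-y)‖/(1+R‖y‖)^σ`. -/
def peetre {d : ℕ} (σ R : ℝ) (g : RD d → ℂ) (x : RD d) : ℝ≥0∞ :=
  ⨆ y : RD d, (‖g (x - y)‖₊ : ℝ≥0∞) / ENNReal.ofReal ((1 + R * ‖y‖) ^ σ)

/-- `g` has (distributional) Fourier support contained in `K`: the pairing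
`⟨ĝ, ψ⟩ = ∫ g · ψ̂` vanishes for every Schwartz `ψ` whose support does not meet `K`. -/
def HasFourierSupportIn {d : ℕ} (g : RD d → ℂ) (K : Set (RD d)) : Prop :=
  ∀ ψ : 𝓢(RD d, ℂ), tsupport ⇑ψ ∩ K = ∅ → ∫ x, g x * fourierS ψ x = 0

/-- The `L^p` (quasi-)norm for `p ∈ (0,∞]` (with `sup` for `p = ∞`). -/
def lpNormFun (d : ℕ) (p : ℝ≥0∞) (g : RD d → ℂ) : ℝ≥0∞ :=
  if p = (⊤ : ℝ≥0∞) then ⨆ x : RD d, (‖g x‖₊ : ℝ≥0∞)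
  else (∫⁻ x, (‖g x‖₊ : ℝ≥0∞) ^ p.toReal) ^ (1/p.toReal)

/-- The Triebel–Lizorkin norm `‖g‖_{F_p^{s,q}}` for `0 < p < ∞`, `0 < q ≤ ∞`, with the
convention `‖g‖_{F_∞^{s,∞}} = ‖g‖_{B_∞^{s,∞}} = sup_{k≥0} 2^{sk}‖Π_k g‖_∞` when `p = ∞`. -/
def TLNorm {d : ℕ} (D : LPData d) (s : ℝ) (p q : ℝ≥0∞) (g : RD d → ℂ) : ℝ≥0∞ :=
  if p = (⊤ : ℝ≥0∞) then ⨆ k : ℕ, (2:ℝ≥0∞)^(s*(k:ℝ)) * ⨆ x : RD d, (‖LP D k g x‖₊ : ℝ≥0∞)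
  else lpNormFun d p (LP D 0 g) +
    (if q = (⊤ : ℝ≥0∞) then
      (∫⁻ x, (⨆ k : ℕ, (2:ℝ≥0∞)^(s*((k:ℝ)+1)) * (‖LP D (k+1) g x‖₊ : ℝ≥0∞)) ^ p.toReal)
        ^ (1/p.toReal)
     else
      (∫⁻ x, ((∑' k : ℕ, ((2:ℝ≥0∞)^(s*((k:ℝ)+1)) * (‖LP D (k+1) g x‖₊ : ℝ≥0∞)) ^ q.toReal)
          ^ (1/q.toReal)) ^ p.toReal) ^ (1/p.toReal))

/-- The Besov norm `‖g‖_{B_p^{s,q}}` for `0 < p, q ≤ ∞`. -/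
def BesovNorm {d : ℕ} (D : LPData d) (s : ℝ) (p q : ℝ≥0∞) (g : RD d → ℂ) : ℝ≥0∞ :=
  lpNormFun d p (LP D 0 g) +
    (if q = (⊤ : ℝ≥0∞) then ⨆ k : ℕ, (2:ℝ≥0∞)^(s*((k:ℝ)+1)) * lpNormFun d p (LP D (k+1) g)
     else (∑' k : ℕ, ((2:ℝ≥0∞)^(s*((k:ℝ)+1)) * lpNormFun d p (LP D (k+1) g)) ^ q.toReal)
       ^ (1/q.toReal))

open scoped FourierTransform

/-- The character `t ↦ e^{2πit}`. -/
def unitChar (t : ℝ) : ℂ := Complex.exp (2 * Real.pi * Complex.I * (t : ℂ))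

lemma norm_unitChar (t : ℝ) : ‖unitChar t‖ = 1 := by
  have : 2 * Real.pi * Complex.I * (t : ℂ) = ((2 * Real.pi * t : ℝ) : ℂ) * Complex.I := by
    push_cast; ring
  rw [unitChar, this, Complex.norm_exp_ofReal_mul_I]

lemma unitChar_add (s t : ℝ) : unitChar (s + t) = unitChar s * unitChar t := by
  simp only [unitChar, ← Complex.exp_add]
  push_cast; ring_nf

lemma contDiff_unitChar : ContDiff ℝ ∞ unitChar := by
  unfold unitChar
  have h : ContDiff ℝ ∞ (fun t : ℝ => 2 * Real.pi * Complex.I * (t : ℂ)) :=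
    contDiff_const.mul Complex.ofRealCLM.contDiff
  exact h.cexp

lemma continuous_unitChar : Continuous unitChar := contDiff_unitChar.continuous

lemma fourierS_apply {d : ℕ} (f : 𝓢(RD d, ℂ)) (ξ : RD d) :
    fourierS f ξ = ∫ x, unitChar (-⟪x, ξ⟫) * f x := by
  change 𝓕 (f : RD d → ℂ) ξ = _
  rw [Real.fourier_eq']
  refine integral_congr_ae (Eventually.of_forall fun x => ?_)
  simp only [unitChar, smul_eq_mul]
  congr 2
  push_cast; ring

/-- The inverse Fourier transform of a Schwartz function. -/
def invS {d : ℕ} (f : 𝓢(RD d, ℂ)) : 𝓢(RD d, ℂ) := 𝓕⁻ f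

lemma fourierS_invS {d : ℕ} (f : 𝓢(RD d, ℂ)) : fourierS (invS f) = f := by
  change 𝓕 (𝓕⁻ f) = f
  exact FourierTransform.fourier_fourierInv_eq f

lemma invS_fourierS {d : ℕ} (f : 𝓢(RD d, ℂ)) : invS (fourierS f) = f :=
  FourierTransform.fourierInv_fourier_eq f

lemma invS_apply {d : ℕ} (f : 𝓢(RD d, ℂ)) (x : RD d) :
    invS f x = ∫ ξ, f ξ * unitChar ⟪x, ξ⟫ := by
  have h : invS f x = 𝓕⁻ (f : RD d → ℂ) x := by
    rw [invS, SchwartzMap.fourierInv_coe]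
  rw [h, Real.fourierInv_eq']
  refine integral_congr_ae (Eventually.of_forall fun y => ?_)
  simp only [unitChar, smul_eq_mul]
  rw [real_inner_comm, mul_comm]
  congr 2
  push_cast; ring

lemma fourierS_fourierS {d : ℕ} (f : 𝓢(RD d, ℂ)) (x : RD d) :
    fourierS (fourierS f) x = f (-x) := by
  conv_rhs => rw [← invS_fourierS f]
  rw [invS_apply, fourierS_apply]
  refine integral_congr_ae (Eventually.of_forall fun y => ?_)
  simp only [inner_neg_left, real_inner_comm, mul_comm]

/-- The modulation `x ↦ e^{2πi⟨x,w⟩} f(x)`, obtained by translating the Fourier transform. -/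
def modS {d : ℕ} (w : RD d) (f : 𝓢(RD d, ℂ)) : 𝓢(RD d, ℂ) :=
  invS (SchwartzMap.compSubConstCLM ℂ w (fourierS f))

lemma fourierS_modS {d : ℕ} (w : RD d) (f : 𝓢(RD d, ℂ)) (ξ : RD d) :
    fourierS (modS w f) ξ = fourierS f (ξ - w) := by
  rw [modS, fourierS_invS, SchwartzMap.compSubConstCLM_apply]

lemma modS_apply {d : ℕ} (w : RD d) (f : 𝓢(RD d, ℂ)) (x : RD d) :
    modS w f x = unitChar ⟪x, w⟫ * f x := by
  conv_rhs => rw [← invS_fourierS f]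
  rw [modS, invS_apply, invS_apply, ← integral_const_mul,
    ← integral_add_right_eq_self _ w]
  refine integral_congr_ae (Eventually.of_forall fun y => ?_)
  simp only [SchwartzMap.compSubConstCLM_apply, add_sub_cancel_right, inner_add_right,
    unitChar_add]
  ring

/-- The `L¹`-normalised dilation `x ↦ r^d f(r x)`, obtained by dilating the Fourier transform. -/
def dilS {d : ℕ} (r : ℝ) (hr : r ≠ 0) (f : 𝓢(RD d, ℂ)) : 𝓢(RD d, ℂ) :=
  invS (SchwartzMap.compCLMOfContinuousLinearEquiv ℂ
    (ContinuousLinearEquiv.smulLeft (Units.mk0 r⁻¹ (inv_ne_zero hr))) (fourierS f))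

lemma fourierS_dilS {d : ℕ} (r : ℝ) (hr : r ≠ 0) (f : 𝓢(RD d, ℂ)) (ξ : RD d) :
    fourierS (dilS r hr f) ξ = fourierS f (r⁻¹ • ξ) := by
  rw [dilS, fourierS_invS]
  rfl

lemma dilS_apply {d : ℕ} (r : ℝ) (hr : 0 < r) (f : 𝓢(RD d, ℂ)) (x : RD d) :
    dilS r hr.ne' f x = ((r ^ d : ℝ) : ℂ) * f (r • x) := by
  conv_rhs => rw [← invS_fourierS f]
  have h := Measure.integral_comp_smul (μ := (volume : Measure (RD d)))
    (fun ξ : RD d => fourierS f ξ * unitChar ⟪r • x, ξ⟫) r⁻¹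
  rw [dilS, invS_apply, invS_apply]
  rw [finrank_euclideanSpace_fin, inv_pow, inv_inv, abs_of_pos (pow_pos hr d)] at h
  rw [← Complex.real_smul, ← h]
  refine integral_congr_ae (Eventually.of_forall fun y => ?_)
  have : ⟪r • x, r⁻¹ • y⟫ = ⟪x, y⟫ := by
    rw [inner_smul_left, inner_smul_right]
    simp [hr.ne']
  simp only [this]
  rfl

lemma fourierS_translate {d : ℕ} (v : RD d) (f : 𝓢(RD d, ℂ)) (ξ : RD d) :
    fourierS (SchwartzMap.compSubConstCLM ℂ v f) ξ = unitChar (-⟪v, ξ⟫) * fourierS f ξ := by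
  rw [fourierS_apply, fourierS_apply, ← integral_const_mul, ← integral_add_right_eq_self _ v]
  refine integral_congr_ae (Eventually.of_forall fun y => ?_)
  simp only [SchwartzMap.compSubConstCLM_apply, add_sub_cancel_right, inner_add_left,
    neg_add, unitChar_add]
  ring

/-- The Littlewood–Paley kernels as Schwartz functions. -/
def LPkernelS {d : ℕ} (D : LPData d) : ℕ → 𝓢(RD d, ℂ)
  | 0 => D.Φ
  | (k+1) => dilS ((2:ℝ)^(k+1)) (by positivity) D.φ

lemma LPkernelS_apply {d : ℕ} (D : LPData d) (k : ℕ) (x : RD d) :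
    LPkernelS D k x = LPkernel D k x := by
  cases k with
  | zero => rfl
  | succ k =>
    rw [LPkernelS, dilS_apply _ (by positivity), LPkernel, pow_mul]

lemma fourierS_LPkernelS {d : ℕ} (D : LPData d) (k : ℕ) (ξ : RD d) :
    fourierS (LPkernelS D k) ξ = LPhat D k ξ := by
  cases k with
  | zero => rfl
  | succ k => rw [LPkernelS, fourierS_dilS, LPhat]

lemma LP_eq_integral_LPhat {d : ℕ} (D : LPData d) (k : ℕ) (f : 𝓢(RD d, ℂ)) (x : RD d) :
    LP D k f x = ∫ ξ, LPhat D k ξ * fourierS f ξ * unitChar ⟪x, ξ⟫ := by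
  have h := SchwartzMap.integral_fourier_mul_eq (LPkernelS D k) (modS x (fourierS f))
  have h1 : ∀ y, fourierS (modS x (fourierS f)) y = f (x - y) := fun y => by
    rw [fourierS_modS, fourierS_fourierS, neg_sub]
  have h2 : LP D k f x = ∫ y, LPkernelS D k y * fourierS (modS x (fourierS f)) y := by
    simp only [h1, LPkernelS_apply, LP]
  rw [h2]
  refine h.symm.trans ?_
  refine integral_congr_ae (Eventually.of_forall fun y => ?_)
  change fourierS (LPkernelS D k) y * modS x (fourierS f) y = _
  simp only [fourierS_LPkernelS, modS_apply, real_inner_comm]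
  ring

lemma LP_eq_zero {d : ℕ} (D : LPData d) (k : ℕ) (f : 𝓢(RD d, ℂ))
    (h : ∀ ξ, fourierS f ξ ≠ 0 → LPhat D k ξ = 0) (x : RD d) : LP D k f x = 0 := by
  rw [LP_eq_integral_LPhat]
  refine integral_eq_zero_of_ae (Eventually.of_forall fun ξ => ?_)
  by_cases hξ : fourierS f ξ = 0
  · simp [hξ]
  · simp [h ξ hξ]

lemma LP_eq_self {d : ℕ} (D : LPData d) (k : ℕ) (f : 𝓢(RD d, ℂ))
    (h : ∀ ξ, fourierS f ξ ≠ 0 → LPhat D k ξ = 1) (x : RD d) : LP D k f x = f x := by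
  rw [LP_eq_integral_LPhat]
  conv_rhs => rw [← invS_fourierS f]
  rw [invS_apply]
  refine integral_congr_ae (Eventually.of_forall fun ξ => ?_)
  by_cases hξ : fourierS f ξ = 0
  · simp [hξ]
  · simp [h ξ hξ]

lemma LP_eq_LPkernel {d : ℕ} (D : LPData d) (k : ℕ) (f : 𝓢(RD d, ℂ))
    (h : ∀ ξ, LPhat D k ξ ≠ 0 → fourierS f ξ = 1) (x : RD d) :
    LP D k f x = LPkernel D k x := by
  rw [LP_eq_integral_LPhat, ← LPkernelS_apply, ← invS_fourierS (LPkernelS D k), invS_apply]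
  refine integral_congr_ae (Eventually.of_forall fun ξ => ?_)
  by_cases hξ : LPhat D k ξ = 0
  · simp [fourierS_LPkernelS, hξ]
  · simp [fourierS_LPkernelS, h ξ hξ]

lemma LP_sum {d : ℕ} (D : LPData d) (k : ℕ) {ι : Type*} (S : Finset ι)
    (F : ι → 𝓢(RD d, ℂ)) (x : RD d) :
    LP D k (⇑(∑ i ∈ S, F i)) x = ∑ i ∈ S, LP D k (F i) x := by
  have hInt : ∀ i, Integrable (fun y => LPkernel D k y * F i (x - y)) := fun i => by
    have h1 : Integrable (fun y => F i (x - y)) := (F i).integrable.comp_sub_left x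
    have h2 : Continuous (fun y => LPkernel D k y) := by
      simp only [← LPkernelS_apply]; exact (LPkernelS D k).continuous
    obtain ⟨C, hC⟩ := (LPkernelS D k).decay 0 0
    refine h1.bdd_mul (c := C) h2.aestronglyMeasurable (Eventually.of_forall fun y => ?_)
    simpa [LPkernelS_apply] using hC.2 y
  unfold LP
  rw [← integral_finsetSum _ (fun i _ => hInt i)]
  simp only [sum_apply, Finset.mul_sum]

lemma LPhat_eq_zero_of_lt_norm {d : ℕ} (D : LPData d) (k : ℕ) {ξ : RD d}
    (h : (2:ℝ)^(k+1) < ‖ξ‖) : LPhat D k ξ = 0 := by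
  cases k with
  | zero =>
    have h2 : 2 < ‖ξ‖ := by simpa using h
    have hξ : ξ ≠ 0 := by
      rintro rfl
      simp at h2
      linarith
    have hs := D.sum_φ ξ hξ
    have hinj : Function.Injective (fun k : ℕ => ((k + 1 : ℕ) : ℤ)) := fun a b hab => by
      simpa using hab
    rw [← hinj.hasSum_iff] at hs
    · rw [LPhat, D.Φ_def, sub_eq_zero, ← hs.tsum_eq]
      refine tsum_congr fun k => ?_
      simp only [Function.comp, zpow_neg, zpow_natCast]
    · intro k hk
      by_contra hne
      have hk0 : k ≤ 0 := by
        by_contra hpos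
        exact hk ⟨(k - 1).toNat, by simp only [Nat.cast_add, Nat.cast_one]; omega⟩
      have := (D.supp_φ _ hne).2
      rw [norm_smul, norm_zpow, Real.norm_ofNat] at this
      have h1 : (1:ℝ) ≤ 2 ^ (-k) := one_le_zpow₀ (by norm_num) (by omega)
      nlinarith
  | succ k =>
    by_contra hne
    have := (D.supp_φ _ hne).2
    rw [norm_smul, norm_inv, norm_pow, Real.norm_ofNat, inv_mul_le_iff₀ (by positivity)] at this
    rw [pow_succ] at h
    linarith

lemma LPhat_succ_eq_zero_of_norm_lt {d : ℕ} (D : LPData d) (k : ℕ) {ξ : RD d}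
    (h : ‖ξ‖ < (2:ℝ)^k) : LPhat D (k+1) ξ = 0 := by
  by_contra hne
  have := (D.supp_φ _ hne).1
  rw [norm_smul, norm_inv, norm_pow, Real.norm_ofNat, le_inv_mul_iff₀ (by positivity),
    pow_succ] at this
  linarith

lemma LPhat_zero_eq_one {d : ℕ} (D : LPData d) {ξ : RD d} (h : ‖ξ‖ < 1) : LPhat D 0 ξ = 1 := by
  have : ∀ k : ℕ, fourierS D.φ (((2:ℝ)^(k+1))⁻¹ • ξ) = 0 := fun k =>
    LPhat_succ_eq_zero_of_norm_lt D k (h.trans_le (one_le_pow₀ (by norm_num)))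
  simp [LPhat, D.Φ_def, this]

lemma exists_fourierS_φ_ne_zero {d : ℕ} (hd : 1 ≤ d) (D : LPData d) :
    ∃ ξ, fourierS D.φ ξ ≠ 0 := by
  by_contra! h
  have hs := D.sum_φ (EuclideanSpace.single ⟨0, hd⟩ 1) (by simp)
  simp only [h] at hs
  exact zero_ne_one (hasSum_zero.unique hs)

lemma integrable_norm_mul_one_add_pow {d : ℕ} (f : 𝓢(RD d, ℂ)) (K : ℕ) :
    Integrable (fun z => ‖f z‖ * (1 + 2 * ‖z‖) ^ K) := by
  have h1 : Integrable (fun z => ‖f z‖) := f.integrable.norm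
  have h2 := f.integrable_pow_mul volume K
  refine ((h1.add (h2.const_mul (2 ^ K))).const_mul (2 ^ (K - 1))).mono'
    (f.continuous.norm.mul (by fun_prop)).aestronglyMeasurable (Eventually.of_forall fun z => ?_)
  rw [Real.norm_of_nonneg (by positivity)]
  have := add_pow_le (zero_le_one' ℝ) (b := 2 * ‖z‖) (by positivity) K
  calc ‖f z‖ * (1 + 2 * ‖z‖) ^ K ≤ ‖f z‖ * (2 ^ (K - 1) * (1 ^ K + (2 * ‖z‖) ^ K)) := by gcongr
    _ = _ := by simp only [Pi.add_apply, one_pow, mul_pow]; ring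

/-- Littlewood–Paley operators at scale at least `k - 1` preserve majorants which vary slowly
at scale `2^{-k}`. -/
lemma exists_norm_LP_le {d : ℕ} (D : LPData d) (K : ℕ) :
    ∃ A : ℝ, 0 ≤ A ∧ ∀ (k j : ℕ), k ≤ j + 1 → ∀ (h : RD d → ℂ) (H : RD d → ℝ),
      (∀ x, ‖h x‖ ≤ H x) → (∀ x y, H (x - y) ≤ H x * (1 + 2 ^ k * ‖y‖) ^ K) →
      ∀ x, ‖LP D j h x‖ ≤ A * H x := by
  refine ⟨(∫ z, ‖D.Φ z‖ * (1 + 2 * ‖z‖) ^ K) + ∫ z, ‖D.φ z‖ * (1 + 2 * ‖z‖) ^ K,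
    add_nonneg (integral_nonneg fun z => by positivity) (integral_nonneg fun z => by positivity),
    fun k j hkj h H hh hH x => ?_⟩
  have hHx : 0 ≤ H x := (norm_nonneg _).trans (hh x)
  have hp : ∀ y, ‖h (x - y)‖ ≤ H x * (1 + 2 ^ k * ‖y‖) ^ K := fun y => (hh _).trans (hH x y)
  cases j with
  | zero =>
    have hb : ∀ y, ‖LPkernel D 0 y * h (x - y)‖ ≤ (‖D.Φ y‖ * (1 + 2 * ‖y‖) ^ K) * H x := by
      intro y
      rw [norm_mul, mul_assoc]
      refine mul_le_mul_of_nonneg_left ((hp y).trans ?_) (norm_nonneg _)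
      rw [mul_comm]
      gcongr
      calc (2:ℝ) ^ k ≤ 2 ^ 1 := pow_le_pow_right₀ (by norm_num) (by omega)
        _ = 2 := pow_one 2
    refine (norm_integral_le_of_norm_le ((integrable_norm_mul_one_add_pow D.Φ K).mul_const _)
      (Eventually.of_forall hb)).trans ?_
    rw [integral_mul_const]
    gcongr
    exact le_add_of_nonneg_right (integral_nonneg fun z => by positivity)
  | succ j =>
    set r : ℝ := 2 ^ (j + 1) with hr
    have hr0 : 0 < r := by positivity
    have hb : ∀ y, ‖LPkernel D (j + 1) y * h (x - y)‖ ≤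
        (‖D.φ (r • y)‖ * (1 + 2 * ‖r • y‖) ^ K) * (r ^ d * H x) := by
      intro y
      have h2 : (2:ℝ) ^ k * ‖y‖ ≤ 2 * ‖r • y‖ := by
        rw [norm_smul, Real.norm_of_nonneg hr0.le, ← mul_assoc]
        gcongr
        rw [hr, ← pow_succ']
        exact pow_le_pow_right₀ (by norm_num) hkj
      rw [norm_mul, LPkernel, norm_mul, Complex.norm_real, pow_mul, ← hr,
        Real.norm_of_nonneg (by positivity)]
      calc r ^ d * ‖D.φ (r • y)‖ * ‖h (x - y)‖
          ≤ r ^ d * ‖D.φ (r • y)‖ * (H x * (1 + 2 * ‖r • y‖) ^ K) := by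
            refine mul_le_mul_of_nonneg_left ((hp y).trans ?_) (by positivity)
            gcongr
        _ = _ := by ring
    have hInt := (integrable_norm_mul_one_add_pow D.φ K).comp_smul hr0.ne'
    refine (norm_integral_le_of_norm_le (hInt.mul_const _) (Eventually.of_forall hb)).trans ?_
    rw [integral_mul_const, Measure.integral_comp_smul volume
      (fun z : RD d => ‖D.φ z‖ * (1 + 2 * ‖z‖) ^ K) r, finrank_euclideanSpace_fin,
      abs_of_pos (by positivity), smul_eq_mul]
    rw [show (r ^ d)⁻¹ * (∫ z, ‖D.φ z‖ * (1 + 2 * ‖z‖) ^ K) * (r ^ d * H x) =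
      (∫ z, ‖D.φ z‖ * (1 + 2 * ‖z‖) ^ K) * H x by field_simp]
    gcongr
    exact le_add_of_nonneg_left (integral_nonneg fun z => by positivity)

lemma lpNormFun_le_mul {d : ℕ} {p : ℝ≥0∞} (hp : 0 < p) {g h : RD d → ℂ} {A : ℝ} (hA : 0 ≤ A)
    (hgh : ∀ x, ‖g x‖ ≤ A * ‖h x‖) :
    lpNormFun d p g ≤ ENNReal.ofReal A * lpNormFun d p h := by
  have hgh' : ∀ x, (‖g x‖₊ : ℝ≥0∞) ≤ ENNReal.ofReal A * (‖h x‖₊ : ℝ≥0∞) := fun x => by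
    change ‖g x‖ₑ ≤ _ * ‖h x‖ₑ
    rw [← ofReal_norm, ← ofReal_norm, ← ENNReal.ofReal_mul hA]
    exact ENNReal.ofReal_le_ofReal (hgh x)
  unfold lpNormFun
  split_ifs with hpt
  · rw [ENNReal.mul_iSup]
    exact iSup_mono hgh'
  · have hp0 : 0 < p.toReal := ENNReal.toReal_pos hp.ne' hpt
    calc (∫⁻ x, (‖g x‖₊ : ℝ≥0∞) ^ p.toReal) ^ (1 / p.toReal)
        ≤ (∫⁻ x, ENNReal.ofReal A ^ p.toReal * (‖h x‖₊ : ℝ≥0∞) ^ p.toReal) ^ (1 / p.toReal) := by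
          gcongr with x
          rw [← ENNReal.mul_rpow_of_nonneg _ _ hp0.le]
          gcongr
          exact hgh' x
      _ = _ := by
          rw [lintegral_const_mul' _ _ (by finiteness),
            ENNReal.mul_rpow_of_nonneg _ _ (by positivity),
            ← ENNReal.rpow_mul, mul_one_div_cancel hp0.ne', ENNReal.rpow_one]

lemma lpNormFun_const_mul {d : ℕ} {p : ℝ≥0∞} (hp : 0 < p) (g : RD d → ℂ) {A : ℝ} (hA : 0 < A) :
    lpNormFun d p (fun x => (A : ℂ) * g x) = ENNReal.ofReal A * lpNormFun d p g := by
  apply le_antisymm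
  · refine lpNormFun_le_mul hp hA.le fun x => ?_
    simp [abs_of_pos hA]
  · have h : lpNormFun d p g ≤ ENNReal.ofReal A⁻¹ * lpNormFun d p (fun x => (A : ℂ) * g x) := by
      refine lpNormFun_le_mul hp (by positivity) fun x => ?_
      rw [norm_mul, Complex.norm_real, Real.norm_of_nonneg hA.le, inv_mul_cancel_left₀ hA.ne']
    calc _ ≤ ENNReal.ofReal A * (ENNReal.ofReal A⁻¹ * lpNormFun d p (fun x => (A : ℂ) * g x)) := by
          gcongr
      _ = _ := by
          rw [← mul_assoc, ← ENNReal.ofReal_mul hA.le, mul_inv_cancel₀ hA.ne', ENNReal.ofReal_one,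
            one_mul]

lemma lpNormFun_zero {d : ℕ} {p : ℝ≥0∞} (hp : 0 < p) : lpNormFun d p (fun _ => 0) = 0 := by
  have := lpNormFun_le_mul (d := d) hp (g := fun _ => 0) (h := fun _ => 0) le_rfl (by simp)
  simpa using this

lemma le_lpNormFun_of_ball {d : ℕ} {p : ℝ≥0∞} (hp : 0 < p) {g : RD d → ℂ} {c δ : ℝ} (hδ : 0 < δ)
    (x₀ : RD d) (h : ∀ x ∈ Metric.ball x₀ δ, c ≤ ‖g x‖) :
    ENNReal.ofReal c * volume (Metric.ball (0 : RD d) δ) ^ (1 / p.toReal) ≤ lpNormFun d p g := by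
  have h' : ∀ x ∈ Metric.ball x₀ δ, ENNReal.ofReal c ≤ (‖g x‖₊ : ℝ≥0∞) := fun x hx => by
    change _ ≤ ‖g x‖ₑ
    rw [← ofReal_norm]
    exact ENNReal.ofReal_le_ofReal (h x hx)
  unfold lpNormFun
  split_ifs with hpt
  · simp only [hpt, ENNReal.toReal_top, div_zero, ENNReal.rpow_zero, mul_one]
    exact (h' x₀ (Metric.mem_ball_self hδ)).trans (le_iSup (fun x => (‖g x‖₊ : ℝ≥0∞)) x₀)
  · have hp0 : 0 < p.toReal := ENNReal.toReal_pos hp.ne' hpt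
    calc _ = (ENNReal.ofReal c ^ p.toReal * volume (Metric.ball x₀ δ)) ^ (1 / p.toReal) := by
          rw [ENNReal.mul_rpow_of_nonneg _ _ (by positivity), ← ENNReal.rpow_mul,
            mul_one_div_cancel hp0.ne', ENNReal.rpow_one,
            Measure.addHaar_ball_center volume x₀]
      _ = (∫⁻ _ in Metric.ball x₀ δ, ENNReal.ofReal c ^ p.toReal) ^ (1 / p.toReal) := by
          rw [setLIntegral_const]
      _ ≤ _ := by
          refine ENNReal.rpow_le_rpow ?_ (by positivity)
          refine (setLIntegral_mono' measurableSet_ball fun x hx => ?_).trans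
            (setLIntegral_le_lintegral (Metric.ball x₀ δ) _)
          gcongr
          exact h' x hx

lemma volume_ball_rpow_pos {d : ℕ} {p : ℝ≥0∞} {δ : ℝ} (hδ : 0 < δ) :
    0 < volume (Metric.ball (0 : RD d) δ) ^ (1 / p.toReal) :=
  ENNReal.rpow_pos (Metric.measure_ball_pos _ _ hδ) measure_ball_lt_top.ne

lemma lpNormFun_pos {d : ℕ} {p : ℝ≥0∞} (hp : 0 < p) {g : RD d → ℂ} (hg : Continuous g)
    {x₀ : RD d} (h : g x₀ ≠ 0) : 0 < lpNormFun d p g := by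
  have hc : 0 < ‖g x₀‖ / 2 := by have := norm_pos_iff.2 h; linarith
  have : ∀ᶠ x in nhds x₀, ‖g x₀‖ / 2 < ‖g x‖ :=
    hg.norm.continuousAt.eventually_const_lt (by linarith)
  obtain ⟨δ, hδ, hb⟩ := Metric.eventually_nhds_iff_ball.1 this
  refine lt_of_lt_of_le ?_ (le_lpNormFun_of_ball hp hδ x₀ fun x hx => (hb x hx).le)
  exact ENNReal.mul_pos (by simpa using h) (volume_ball_rpow_pos hδ).ne'

lemma lpNormFun_dilation {d : ℕ} {p : ℝ≥0∞} (hp : 0 < p) (hpt : p ≠ ⊤) {g : RD d → ℂ}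
    (hg : Continuous g) {r : ℝ} (hr : 0 < r) :
    lpNormFun d p (fun x => ((r ^ d : ℝ) : ℂ) * g (r • x)) =
      ENNReal.ofReal (r ^ ((d : ℝ) - d / p.toReal)) * lpNormFun d p g := by
  rw [lpNormFun_const_mul hp (fun x => g (r • x)) (by positivity)]
  have hp0 : 0 < p.toReal := ENNReal.toReal_pos hp.ne' hpt
  have key : ∫⁻ x, (‖g (r • x)‖₊ : ℝ≥0∞) ^ p.toReal =
      ENNReal.ofReal ((r ^ d)⁻¹) * ∫⁻ x, (‖g x‖₊ : ℝ≥0∞) ^ p.toReal := by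
    have h := lintegral_map (μ := (volume : Measure (RD d)))
      (f := fun x => (‖g x‖₊ : ℝ≥0∞) ^ p.toReal) (g := fun x => r • x)
      (by fun_prop) (by fun_prop)
    rw [← h]
    change ∫⁻ x, _ ∂(Measure.map (r • ·) volume) = _
    rw [Measure.map_addHaar_smul volume hr.ne', lintegral_smul_measure, finrank_euclideanSpace_fin,
      abs_of_pos (by positivity), smul_eq_mul]
  simp only [lpNormFun, hpt, if_false]
  rw [key, ENNReal.mul_rpow_of_nonneg _ _ (by positivity), ← mul_assoc,
    ENNReal.ofReal_rpow_of_pos (by positivity), ← ENNReal.ofReal_mul (by positivity)]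
  congr 2
  rw [← Real.rpow_natCast, ← Real.rpow_neg hr.le, ← Real.rpow_mul hr.le, ← Real.rpow_add hr]
  congr 1
  ring

/-- The `k`-th dyadic piece of the symbol: it moves the frequency `2^k e` to the origin. -/
def shiftPiece {d : ℕ} (m : ℝ) (e : RD d) (ψ : RD d → ℝ) (k : ℕ) (x ξ : RD d) : ℂ :=
  ψ (((2:ℝ)^k)⁻¹ • ξ) • ((((2:ℝ)^k) ^ m) • unitChar (-⟪(2:ℝ)^k • x, e⟫))

/-- The symbol moving each frequency `2^k e` to the origin. -/
def shiftSymbol {d : ℕ} (m : ℝ) (e : RD d) (ψ : RD d → ℝ) (x ξ : RD d) : ℂ :=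
  ∑' k : ℕ, shiftPiece m e ψ k x ξ

lemma norm_iteratedFDeriv_unitChar_inner {d : ℕ} (e : RD d) (β : ℕ) (x : RD d) :
    ‖iteratedFDeriv ℝ β (fun x => unitChar (-⟪x, e⟫)) x‖ =
      ‖iteratedFDeriv ℝ β (fun x => unitChar (-⟪x, e⟫)) 0‖ := by
  have hu : ContDiff ℝ β (fun x : RD d => unitChar (-⟪x, e⟫)) :=
    (contDiff_unitChar.comp (contDiff_id.inner ℝ contDiff_const).neg).of_le (mod_cast le_top)
  have h := iteratedFDeriv_comp_add_right (𝕜 := ℝ) (f := fun x => unitChar (-⟪x, e⟫)) β x 0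
  rw [zero_add] at h
  have h2 : (fun z => unitChar (-⟪z + x, e⟫)) =
      fun z => unitChar (-⟪x, e⟫) • unitChar (-⟪z, e⟫) := by
    funext z
    rw [inner_add_left, neg_add, unitChar_add, smul_eq_mul, mul_comm]
  rw [← h, h2, iteratedFDeriv_const_smul_apply' hu.contDiffAt, norm_smul, norm_unitChar, one_mul]

lemma rpow_le_of_comparable {a b E : ℝ} (ha : 0 < a) (hb : 0 < b) (h1 : a ≤ 3 * b)
    (h2 : b ≤ 3 * a) : a ^ E ≤ 3 ^ |E| * b ^ E := by
  rcases le_total 0 E with hE | hE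
  · rw [abs_of_nonneg hE, ← Real.mul_rpow (by norm_num) hb.le]
    exact Real.rpow_le_rpow ha.le h1 hE
  · rw [abs_of_nonpos hE, Real.rpow_neg (by norm_num), ← Real.inv_rpow (by norm_num),
      ← Real.mul_rpow (by norm_num) hb.le]
    exact Real.rpow_le_rpow_of_nonpos (by positivity) (by linarith) hE

section

variable {d : ℕ} {m : ℝ} {e : RD d} {ψ : RD d → ℝ}

lemma eventually_bump_eq_zero (hψ : ∀ ξ, ψ ξ ≠ 0 → 9 / 10 ≤ ‖ξ‖ ∧ ‖ξ‖ ≤ 11 / 10) (ξ₀ : RD d) :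
    ∃ k₀ : ℕ, ∀ᶠ ξ in nhds ξ₀, ∀ k ≠ k₀, ψ (((2:ℝ)^k)⁻¹ • ξ) = 0 := by
  have hex : ∃ k : ℕ, ‖ξ₀‖ < 3 / 2 * 2 ^ k := by
    obtain ⟨k, hk⟩ := pow_unbounded_of_one_lt ‖ξ₀‖ (one_lt_two : (1:ℝ) < 2)
    exact ⟨k, by linarith [norm_nonneg ξ₀]⟩
  classical
  refine ⟨Nat.find hex, ?_⟩
  set k₀ := Nat.find hex with hk₀
  have h1 : ‖ξ₀‖ < 3 / 2 * 2 ^ k₀ := Nat.find_spec hex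
  have hU : ∀ᶠ ξ in nhds ξ₀, ‖ξ‖ < 3 / 2 * 2 ^ k₀ :=
    continuous_norm.continuousAt.eventually_lt_const h1
  have hL : ∀ᶠ ξ in nhds ξ₀, ∀ k < k₀, 11 / 10 * 2 ^ k < ‖ξ‖ := by
    rcases Nat.eq_zero_or_pos k₀ with h0 | h0
    · exact Eventually.of_forall fun ξ k hk => by omega
    · have h2 : 3 / 2 * 2 ^ (k₀ - 1) ≤ ‖ξ₀‖ := not_lt.1 (Nat.find_min hex (by omega))
      have h3 : (11 / 10 : ℝ) * 2 ^ (k₀ - 1) < ‖ξ₀‖ :=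
        lt_of_lt_of_le (mul_lt_mul_of_pos_right (by norm_num) (by positivity)) h2
      filter_upwards [continuous_norm.continuousAt.eventually_const_lt h3] with ξ hξ k hk
      refine lt_of_le_of_lt ?_ hξ
      have : (2:ℝ) ^ k ≤ 2 ^ (k₀ - 1) := pow_le_pow_right₀ (by norm_num) (by omega)
      gcongr
  filter_upwards [hU, hL] with ξ hξU hξL k hk
  by_contra hne
  have hs := hψ _ hne
  rw [norm_smul, norm_inv, norm_pow, Real.norm_ofNat, le_inv_mul_iff₀ (by positivity),
    inv_mul_le_iff₀ (by positivity)] at hs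
  rcases lt_or_gt_of_ne hk with hlt | hgt
  · have := hξL k hlt
    linarith
  · have : (2:ℝ) ^ (k₀ + 1) ≤ 2 ^ k := pow_le_pow_right₀ (by norm_num) (by omega)
    rw [pow_succ] at this
    have : (0:ℝ) < 2 ^ k₀ := by positivity
    linarith

lemma shiftSymbol_eq_shiftPiece {k₀ : ℕ} {ξ : RD d}
    (h : ∀ k ≠ k₀, ψ (((2:ℝ)^k)⁻¹ • ξ) = 0) (x : RD d) :
    shiftSymbol m e ψ x ξ = shiftPiece m e ψ k₀ x ξ :=
  tsum_eq_single k₀ fun k hk => by rw [shiftPiece, h k hk, zero_smul]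

lemma norm_iteratedFDeriv_shiftPiece_le (hψ : ContDiff ℝ ∞ ψ) (α β k : ℕ) (x ξ : RD d) :
    ‖iteratedFDeriv ℝ α
        (fun ξ' => iteratedFDeriv ℝ β (fun x' => shiftPiece m e ψ k x' ξ') x) ξ‖ ≤
      ‖iteratedFDeriv ℝ α ψ (((2:ℝ)^k)⁻¹ • ξ)‖ *
        ‖iteratedFDeriv ℝ β (fun x => unitChar (-⟪x, e⟫)) 0‖ *
        ((2:ℝ)^k) ^ (m - (α : ℝ) + (β : ℝ)) := by
  have hr : (0:ℝ) < 2 ^ k := by positivity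
  set r : ℝ := 2 ^ k
  set u : RD d → ℂ := fun x => unitChar (-⟪x, e⟫) with hudef
  have hu : ContDiff ℝ β u :=
    (contDiff_unitChar.comp (contDiff_id.inner ℝ contDiff_const).neg).of_le (mod_cast le_top)
  have hur : ContDiff ℝ β (fun x => u (r • x)) := hu.comp (by fun_prop)
  set V := iteratedFDeriv ℝ β (fun x' => (r ^ m) • u (r • x')) x with hV
  have hVn : ‖V‖ = r ^ m * (r ^ β * ‖iteratedFDeriv ℝ β u 0‖) := by
    rw [hV, iteratedFDeriv_const_smul_apply' hur.contDiffAt, iteratedFDeriv_comp_const_smul _ hu,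
      norm_smul, norm_smul, norm_iteratedFDeriv_unitChar_inner, norm_pow,
      Real.norm_of_nonneg hr.le, Real.norm_of_nonneg (by positivity)]
  have hin : (fun ξ' => iteratedFDeriv ℝ β (fun x' => shiftPiece m e ψ k x' ξ') x) =
      (ContinuousLinearMap.toSpanSingleton ℝ V) ∘ (fun ξ' => ψ (r⁻¹ • ξ')) := by
    funext ξ'
    simp only [Function.comp, ContinuousLinearMap.toSpanSingleton_apply, hV]
    exact iteratedFDeriv_const_smul_apply' (hur.const_smul _).contDiffAt
  have hψα : ContDiff ℝ α ψ := hψ.of_le (mod_cast le_top)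
  have hψr : ContDiff ℝ α (fun ξ' => ψ (r⁻¹ • ξ')) := hψα.comp (by fun_prop)
  rw [hin, ContinuousLinearMap.iteratedFDeriv_comp_left _ hψr.contDiffAt le_rfl]
  refine (ContinuousLinearMap.norm_compContinuousMultilinearMap_le _ _).trans (le_of_eq ?_)
  rw [ContinuousLinearMap.norm_toSpanSingleton, iteratedFDeriv_comp_const_smul _ hψα, norm_smul,
    hVn, norm_pow, norm_inv, Real.norm_of_nonneg hr.le, Real.rpow_add hr, Real.rpow_sub hr,
    Real.rpow_natCast, Real.rpow_natCast, inv_pow]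
  generalize ‖iteratedFDeriv ℝ α ψ (r⁻¹ • ξ)‖ = X
  field_simp

lemma isSymbolS11_shiftSymbol (hψ : ContDiff ℝ ∞ ψ) (hc : HasCompactSupport ψ)
    (hs : ∀ ξ, ψ ξ ≠ 0 → 9 / 10 ≤ ‖ξ‖ ∧ ‖ξ‖ ≤ 11 / 10) :
    IsSymbolS11 d m (shiftSymbol m e ψ) := by
  constructor
  · rw [contDiff_iff_contDiffAt]
    rintro ⟨x, ξ₀⟩
    obtain ⟨k, hk⟩ := eventually_bump_eq_zero hs ξ₀
    have hsm : ContDiff ℝ ∞ (fun p : RD d × RD d => shiftPiece m e ψ k p.1 p.2) := by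
      have h1 : ContDiff ℝ ∞ (fun p : RD d × RD d => ψ (((2:ℝ)^k)⁻¹ • p.2)) :=
        hψ.comp (contDiff_snd.const_smul _)
      have h2 : ContDiff ℝ ∞ (fun p : RD d × RD d => unitChar (-⟪(2:ℝ)^k • p.1, e⟫)) :=
        contDiff_unitChar.comp ((contDiff_fst.const_smul _).inner ℝ contDiff_const).neg
      exact h1.smul (h2.const_smul _)
    refine hsm.contDiffAt.congr_of_eventuallyEq ?_
    filter_upwards [continuous_snd.continuousAt.eventually hk] with p hp
    exact shiftSymbol_eq_shiftPiece hp _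
  · intro α β
    obtain ⟨N, hN⟩ := (hψ.continuous_iteratedFDeriv (m := α)
      (mod_cast le_top)).bounded_above_of_compact_support (hc.iteratedFDeriv α)
    have hN0 : 0 ≤ N := (norm_nonneg _).trans (hN 0)
    set M := ‖iteratedFDeriv ℝ β (fun x => unitChar (-⟪x, e⟫)) 0‖
    set E := m - (α : ℝ) + (β : ℝ)
    refine ⟨N * M * 3 ^ |E|, fun x ξ => ?_⟩
    obtain ⟨k, hk⟩ := eventually_bump_eq_zero hs ξ
    have heq : (fun ξ' => iteratedFDeriv ℝ β (fun x' => shiftSymbol m e ψ x' ξ') x) =ᶠ[nhds ξ]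
        fun ξ' => iteratedFDeriv ℝ β (fun x' => shiftPiece m e ψ k x' ξ') x := by
      filter_upwards [hk] with ξ' hξ'
      congr 1
      funext x'
      exact shiftSymbol_eq_shiftPiece hξ' x'
    rw [(heq.iteratedFDeriv ℝ α).eq_of_nhds]
    refine (norm_iteratedFDeriv_shiftPiece_le hψ α β k x ξ).trans ?_
    by_cases h0 : iteratedFDeriv ℝ α ψ (((2:ℝ)^k)⁻¹ • ξ) = 0
    · rw [h0, norm_zero, zero_mul, zero_mul]
      positivity
    · have hmem : ((2:ℝ)^k)⁻¹ • ξ ∈ tsupport ψ := support_iteratedFDeriv_subset α h0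
      have hcl : tsupport ψ ⊆ {ζ | 9 / 10 ≤ ‖ζ‖ ∧ ‖ζ‖ ≤ 11 / 10} :=
        closure_minimal (fun ζ hζ => hs ζ hζ)
          ((isClosed_le continuous_const continuous_norm).inter
            (isClosed_le continuous_norm continuous_const))
      have h := hcl hmem
      simp only [Set.mem_ofPred_eq] at h
      rw [norm_smul, norm_inv, norm_pow, Real.norm_ofNat, le_inv_mul_iff₀ (by positivity),
        inv_mul_le_iff₀ (by positivity)] at h
      have h1 : (1:ℝ) ≤ 2 ^ k := one_le_pow₀ (by norm_num)
      have hcmp := rpow_le_of_comparable (E := E) (a := 2 ^ k) (b := 1 + ‖ξ‖) (by positivity)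
        (by positivity) (by linarith) (by linarith)
      calc _ ≤ N * M * (3 ^ |E| * (1 + ‖ξ‖) ^ E) := by
            gcongr
            exact hN _
        _ = _ := by ring

end

/-- The function `f` with normalisation `2^{-km}`, moved in frequency to `2^k e`. -/
def liftS {d : ℕ} (m : ℝ) (e : RD d) (k : ℕ) (f : 𝓢(RD d, ℂ)) : 𝓢(RD d, ℂ) :=
  ((((2:ℝ)^k) ^ (-m) : ℝ) : ℂ) • modS ((2:ℝ)^k • e) f

lemma fourierS_smul {d : ℕ} (c : ℂ) (f : 𝓢(RD d, ℂ)) (ξ : RD d) :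
    fourierS (c • f) ξ = c * fourierS f ξ := by
  rw [fourierS, map_smul]
  rfl

lemma fourierS_sum {d : ℕ} {ι : Type*} (S : Finset ι) (F : ι → 𝓢(RD d, ℂ)) (ξ : RD d) :
    fourierS (∑ i ∈ S, F i) ξ = ∑ i ∈ S, fourierS (F i) ξ := by
  rw [fourierS, map_sum, _root_.sum_apply]
  rfl

lemma fourierS_liftS {d : ℕ} (m : ℝ) (e : RD d) (k : ℕ) (f : 𝓢(RD d, ℂ)) (ξ : RD d) :
    fourierS (liftS m e k f) ξ =
      ((((2:ℝ)^k) ^ (-m) : ℝ) : ℂ) * fourierS f (ξ - (2:ℝ)^k • e) := by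
  rw [liftS, fourierS_smul, fourierS_modS]

lemma norm_liftS_apply {d : ℕ} (m : ℝ) (e : RD d) (k : ℕ) (f : 𝓢(RD d, ℂ)) (x : RD d) :
    ‖liftS m e k f x‖ = ((2:ℝ)^k) ^ (-m) * ‖f x‖ := by
  rw [liftS, _root_.smul_apply, modS_apply, norm_smul, norm_mul, norm_unitChar, one_mul,
    Complex.norm_real, Real.norm_of_nonneg (by positivity)]

lemma norm_mem_of_fourierS_liftS_ne_zero {d : ℕ} {m : ℝ} {e : RD d} (he : ‖e‖ = 1) {k : ℕ}
    {f : 𝓢(RD d, ℂ)} (hf : ∀ ξ, fourierS f ξ ≠ 0 → ‖ξ‖ ≤ 2 ^ k / 20) {ξ : RD d}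
    (h : fourierS (liftS m e k f) ξ ≠ 0) :
    19 / 20 * 2 ^ k ≤ ‖ξ‖ ∧ ‖ξ‖ ≤ 21 / 20 * 2 ^ k := by
  rw [fourierS_liftS] at h
  have h1 := hf _ (right_ne_zero_of_mul h)
  have h2 : ‖(2:ℝ)^k • e‖ = 2 ^ k := by rw [norm_smul, he, norm_pow, Real.norm_ofNat, mul_one]
  have h3 := norm_sub_norm_le ξ ((2:ℝ)^k • e)
  have h4 := norm_sub_norm_le ((2:ℝ)^k • e) ξ
  rw [norm_sub_rev] at h4
  constructor <;> linarith

lemma LP_liftS_eq_zero {d : ℕ} (D : LPData d) {m : ℝ} {e : RD d} (he : ‖e‖ = 1) {k j : ℕ}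
    {f : 𝓢(RD d, ℂ)} (hf : ∀ ξ, fourierS f ξ ≠ 0 → ‖ξ‖ ≤ 2 ^ k / 20)
    (h : k + 2 ≤ j ∨ j + 2 ≤ k) (x : RD d) : LP D j (liftS m e k f) x = 0 := by
  refine LP_eq_zero D j _ (fun ξ hξ => ?_) x
  have hn := norm_mem_of_fourierS_liftS_ne_zero he hf hξ
  have hk : (0:ℝ) < 2 ^ k := by positivity
  rcases h with h | h
  · obtain ⟨j, rfl⟩ : ∃ i, j = i + 1 := ⟨j - 1, by omega⟩
    refine LPhat_succ_eq_zero_of_norm_lt D j ?_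
    have : (2:ℝ) ^ (k + 1) ≤ 2 ^ j := pow_le_pow_right₀ (by norm_num) (by omega)
    rw [pow_succ] at this
    linarith
  · refine LPhat_eq_zero_of_lt_norm D j ?_
    have : (2:ℝ) ^ (j + 1 + 1) ≤ 2 ^ k := pow_le_pow_right₀ (by norm_num) (by omega)
    rw [pow_succ] at this
    linarith

lemma pdo_shiftSymbol_sum_liftS {d : ℕ} {m : ℝ} {e : RD d} {ψ : RD d → ℝ}
    (hone : ∀ ξ, ‖ξ - e‖ ≤ 1 / 20 → ψ ξ = 1)
    (hs : ∀ ξ, ψ ξ ≠ 0 → 9 / 10 ≤ ‖ξ‖ ∧ ‖ξ‖ ≤ 11 / 10) (S : Finset ℕ) (G : ℕ → 𝓢(RD d, ℂ))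
    (hG : ∀ k ∈ S, ∀ ξ, fourierS (G k) ξ ≠ 0 → ‖ξ‖ ≤ 2 ^ k / 20) (x : RD d) :
    pdo (shiftSymbol m e ψ) (∑ k ∈ S, liftS m e k (G k)) x = ∑ k ∈ S, G k x := by
  have hterm : ∀ k ∈ S, ∀ ξ,
      shiftSymbol m e ψ x ξ * fourierS (liftS m e k (G k)) ξ * unitChar ⟪x, ξ⟫ =
        fourierS (G k) (ξ - (2:ℝ)^k • e) * unitChar ⟪x, ξ - (2:ℝ)^k • e⟫ := by
    intro k hk ξ
    by_cases h0 : fourierS (G k) (ξ - (2:ℝ)^k • e) = 0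
    · rw [fourierS_liftS, h0]
      simp
    have hk0 : (0:ℝ) < 2 ^ k := by positivity
    have hψ1 : ψ (((2:ℝ)^k)⁻¹ • ξ) = 1 := by
      apply hone
      have h1 := hG k hk _ h0
      have h2 : ((2:ℝ)^k)⁻¹ • ξ - e = ((2:ℝ)^k)⁻¹ • (ξ - (2:ℝ)^k • e) := by
        rw [smul_sub, inv_smul_smul₀ hk0.ne']
      rw [h2, norm_smul, norm_inv, norm_pow, Real.norm_ofNat, inv_mul_le_iff₀ hk0]
      linarith
    have hvan : ∀ l ≠ k, ψ (((2:ℝ)^l)⁻¹ • ξ) = 0 := by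
      obtain ⟨k₀, hk₀⟩ := eventually_bump_eq_zero hs ξ
      have h := hk₀.self_of_nhds
      have hkk : k = k₀ := by
        by_contra hne
        exact one_ne_zero (hψ1.symm.trans (h k hne))
      rw [hkk]
      exact h
    rw [shiftSymbol_eq_shiftPiece hvan, shiftPiece, hψ1, one_smul, fourierS_liftS,
      inner_sub_right, sub_eq_add_neg ⟪x, ξ⟫, unitChar_add, Complex.real_smul, inner_smul_left,
      inner_smul_right]
    have hc : ((((2:ℝ)^k) ^ m : ℝ) : ℂ) * ((((2:ℝ)^k) ^ (-m) : ℝ) : ℂ) = 1 := by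
      rw [← Complex.ofReal_mul, ← Real.rpow_add hk0]
      simp
    simp only [conj_trivial]
    linear_combination (unitChar (-((2:ℝ)^k * ⟪x, e⟫)) * fourierS (G k) (ξ - (2:ℝ)^k • e) *
      unitChar ⟪x, ξ⟫) * hc
  have hInt : ∀ k, Integrable fun ξ => fourierS (G k) ξ * unitChar ⟪x, ξ⟫ := fun k => by
    refine (modS x (fourierS (G k))).integrable.congr (Eventually.of_forall fun ξ => ?_)
    simp only [modS_apply, real_inner_comm, mul_comm]
  calc pdo (shiftSymbol m e ψ) (∑ k ∈ S, liftS m e k (G k)) x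
      = ∫ ξ, ∑ k ∈ S, fourierS (G k) (ξ - (2:ℝ)^k • e) * unitChar ⟪x, ξ - (2:ℝ)^k • e⟫ := by
        refine integral_congr_ae (Eventually.of_forall fun ξ => ?_)
        simp only [fourierS_sum]
        rw [Finset.mul_sum, Finset.sum_mul]
        exact Finset.sum_congr rfl fun k hk => hterm k hk ξ
    _ = ∑ k ∈ S, ∫ ξ, fourierS (G k) (ξ - (2:ℝ)^k • e) * unitChar ⟪x, ξ - (2:ℝ)^k • e⟫ :=
        integral_finsetSum _ fun k _ => (hInt k).comp_sub_right _
    _ = ∑ k ∈ S, G k x := by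
        refine Finset.sum_congr rfl fun k _ => ?_
        rw [integral_sub_right_eq_self (fun ξ => fourierS (G k) ξ * unitChar ⟪x, ξ⟫),
          ← invS_apply, invS_fourierS]

lemma ENNReal_two_rpow (t : ℝ) : (2:ℝ≥0∞) ^ t = ENNReal.ofReal ((2:ℝ) ^ t) := by
  rw [← ENNReal.ofReal_rpow_of_pos (by norm_num), ENNReal.ofReal_ofNat]

lemma lpNormFun_LP_zero_le_BesovNorm {d : ℕ} (D : LPData d) (s : ℝ) (p q : ℝ≥0∞)
    (g : RD d → ℂ) : lpNormFun d p (LP D 0 g) ≤ BesovNorm D s p q g :=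
  le_self_add

lemma card_rpow_mul_le_BesovNorm {d : ℕ} (D : LPData d) (s : ℝ) (p : ℝ≥0∞) {q : ℝ≥0∞}
    (hq : 0 < q) (hqt : q ≠ ⊤) (g : RD d → ℂ) (U : Finset ℕ) (b : ℝ≥0∞)
    (hU : ∀ j ∈ U, b ≤ (2:ℝ≥0∞)^(s*((j:ℝ)+1)) * lpNormFun d p (LP D (j+1) g)) :
    (U.card : ℝ≥0∞) ^ (1 / q.toReal) * b ≤ BesovNorm D s p q g := by
  have hq0 : 0 < q.toReal := ENNReal.toReal_pos hq.ne' hqt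
  refine le_trans ?_ le_add_self
  rw [if_neg hqt]
  calc (U.card : ℝ≥0∞) ^ (1 / q.toReal) * b
      = ((U.card : ℝ≥0∞) * b ^ q.toReal) ^ (1 / q.toReal) := by
        rw [ENNReal.mul_rpow_of_nonneg _ _ (by positivity), ← ENNReal.rpow_mul,
          mul_one_div_cancel hq0.ne', ENNReal.rpow_one]
    _ ≤ _ := by
        refine ENNReal.rpow_le_rpow ?_ (by positivity)
        refine le_trans ?_ (ENNReal.sum_le_tsum U)
        rw [← nsmul_eq_mul]
        exact Finset.card_nsmul_le_sum _ _ _ fun j hj =>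
          ENNReal.rpow_le_rpow (hU j hj) hq0.le

lemma BesovNorm_le_card_rpow_mul {d : ℕ} (D : LPData d) (s : ℝ) (p : ℝ≥0∞) {q : ℝ≥0∞}
    (hq : 0 < q) (g : RD d → ℂ) (h0 : lpNormFun d p (LP D 0 g) = 0) (U : Finset ℕ) (N : ℕ)
    (hN : U.card ≤ N) (X : ℝ≥0∞)
    (hU : ∀ j ∈ U, (2:ℝ≥0∞)^(s*((j:ℝ)+1)) * lpNormFun d p (LP D (j+1) g) ≤ X)
    (hU' : ∀ j ∉ U, (2:ℝ≥0∞)^(s*((j:ℝ)+1)) * lpNormFun d p (LP D (j+1) g) = 0) :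
    BesovNorm D s p q g ≤ (N : ℝ≥0∞) ^ (1 / q.toReal) * X := by
  rw [BesovNorm, h0, zero_add]
  split_ifs with hqt
  · simp only [hqt, ENNReal.toReal_top, div_zero, ENNReal.rpow_zero, one_mul]
    refine iSup_le fun j => ?_
    by_cases hj : j ∈ U
    · exact hU j hj
    · rw [hU' j hj]
      exact zero_le
  · have hq0 : 0 < q.toReal := ENNReal.toReal_pos hq.ne' hqt
    rw [tsum_eq_sum (s := U) fun j hj => by rw [hU' j hj, ENNReal.zero_rpow_of_pos hq0]]
    calc _ ≤ ((N : ℝ≥0∞) * X ^ q.toReal) ^ (1 / q.toReal) := by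
          refine ENNReal.rpow_le_rpow ?_ (by positivity)
          refine (Finset.sum_le_card_nsmul U _ (X ^ q.toReal) fun j hj =>
            ENNReal.rpow_le_rpow (hU j hj) hq0.le).trans ?_
          rw [nsmul_eq_mul]
          gcongr
      _ = _ := by
          rw [ENNReal.mul_rpow_of_nonneg _ _ (by positivity), ← ENNReal.rpow_mul,
            mul_one_div_cancel hq0.ne', ENNReal.rpow_one]

/-- Upper bound for the Besov norm of a sum of frequency shifted functions with separated
frequencies, in terms of slowly varying majorants. -/
lemma exists_BesovNorm_sum_liftS_le {d : ℕ} (D : LPData d) (K : ℕ) (s m : ℝ) {p q : ℝ≥0∞}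
    (hp : 0 < p) (hq : 0 < q) {e : RD d} (he : ‖e‖ = 1) :
    ∃ A : ℝ, 0 ≤ A ∧ ∀ (S : Finset ℕ) (G : ℕ → 𝓢(RD d, ℂ)) (H : ℕ → RD d → ℝ) (B : ℝ≥0∞),
      (∀ k ∈ S, 2 ≤ k) → (∀ k ∈ S, ∀ l ∈ S, k ≠ l → k + 3 ≤ l ∨ l + 3 ≤ k) →
      (∀ k ∈ S, ∀ ξ, fourierS (G k) ξ ≠ 0 → ‖ξ‖ ≤ 2 ^ k / 20) →
      (∀ k ∈ S, ∀ x, ‖G k x‖ ≤ H k x) →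
      (∀ k ∈ S, ∀ x y, H k (x - y) ≤ H k x * (1 + 2 ^ k * ‖y‖) ^ K) →
      (∀ k ∈ S, ENNReal.ofReal (((2:ℝ) ^ k) ^ s) *
        lpNormFun d p (fun x => (H k x : ℂ)) ≤ B) →
      BesovNorm D (s + m) p q (⇑(∑ k ∈ S, liftS m e k (G k))) ≤
        ((3 * S.card : ℕ) : ℝ≥0∞) ^ (1 / q.toReal) * (ENNReal.ofReal A * B) := by
  obtain ⟨A, hA, hLP⟩ := exists_norm_LP_le D K
  refine ⟨2 ^ |s + m| * A, by positivity, fun S G H B hS2 hsep hG hH hslow hB => ?_⟩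
  have hLPsum : ∀ j x, LP D j (⇑(∑ k ∈ S, liftS m e k (G k))) x =
      ∑ k ∈ S, LP D j (liftS m e k (G k)) x := fun j x => LP_sum D j S _ x
  have hfar : ∀ j, (∀ k ∈ S, k + 2 ≤ j ∨ j + 2 ≤ k) →
      lpNormFun d p (LP D j (⇑(∑ k ∈ S, liftS m e k (G k)))) = 0 := fun j hj => by
    rw [← lpNormFun_zero (d := d) hp]
    congr 1
    funext x
    rw [hLPsum]
    exact Finset.sum_eq_zero fun k hk => LP_liftS_eq_zero D he (hG k hk) (hj k hk) x
  refine BesovNorm_le_card_rpow_mul D (s + m) p hq _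
    (hfar 0 fun k hk => Or.inr (by have := hS2 k hk; omega))
    (S.biUnion fun k => {k - 2, k - 1, k}) _ ?_ _ ?_ ?_
  · rw [mul_comm]
    exact Finset.card_biUnion_le_card_mul _ _ _ fun k _ => Finset.card_le_three
  · intro j hj
    rw [Finset.mem_biUnion] at hj
    obtain ⟨k, hk, hjk⟩ := hj
    have hk2 := hS2 k hk
    have hjk' : k ≤ j + 2 ∧ j ≤ k := by
      simp only [Finset.mem_insert, Finset.mem_singleton] at hjk
      omega
    have hpt : ∀ x, ‖LP D (j+1) (⇑(∑ k ∈ S, liftS m e k (G k))) x‖ ≤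
        (A * ((2:ℝ)^k) ^ (-m)) * ‖(H k x : ℂ)‖ := fun x => by
      rw [hLPsum, Finset.sum_eq_single k]
      · have hx : 0 ≤ H k x := (norm_nonneg _).trans (hH k hk x)
        rw [Complex.norm_real, Real.norm_of_nonneg hx, mul_assoc]
        refine hLP k (j+1) (by omega) _ (fun x => ((2:ℝ)^k) ^ (-m) * H k x) (fun y => ?_)
          (fun y z => ?_) x
        · rw [norm_liftS_apply]
          exact mul_le_mul_of_nonneg_left (hH k hk y) (by positivity)
        · rw [mul_assoc]
          exact mul_le_mul_of_nonneg_left (hslow k hk y z) (by positivity)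
      · intro l hl hlk
        refine LP_liftS_eq_zero D he (hG l hl) ?_ x
        have := hsep l hl k hk hlk
        omega
      · exact fun h => absurd hk h
    have hnorm := lpNormFun_le_mul hp (by positivity) hpt
    have hexp : (2:ℝ) ^ ((s + m) * ((j:ℝ) + 1)) * (A * ((2:ℝ)^k) ^ (-m)) ≤
        2 ^ |s + m| * A * ((2:ℝ)^k) ^ s := by
      have h1 : (s + m) * ((j:ℝ) + 1) ≤ |s + m| + k * (s + m) := by
        have h2 : |(j:ℝ) + 1 - k| ≤ 1 := by
          have h3 : (k:ℝ) ≤ j + 2 := mod_cast hjk'.1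
          have h4 : (j:ℝ) ≤ k := mod_cast hjk'.2
          rw [abs_le]
          constructor <;> linarith
        have h5 : (s + m) * ((j:ℝ) + 1 - k) ≤ |s + m| := by
          refine (le_abs_self _).trans ?_
          rw [abs_mul]
          exact mul_le_of_le_one_right (abs_nonneg _) h2
        linarith
      have h6 : (2:ℝ) ^ ((s + m) * ((j:ℝ) + 1)) ≤ 2 ^ |s + m| * ((2:ℝ)^k) ^ (s + m) := by
        rw [← Real.rpow_natCast, ← Real.rpow_mul (by norm_num), ← Real.rpow_add (by norm_num)]
        exact Real.rpow_le_rpow_of_exponent_le (by norm_num) h1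
      have h7 : ((2:ℝ)^k) ^ (s + m) * ((2:ℝ)^k) ^ (-m) = ((2:ℝ)^k) ^ s := by
        rw [← Real.rpow_add (by positivity)]
        ring_nf
      calc _ ≤ (2 ^ |s + m| * ((2:ℝ)^k) ^ (s + m)) * (A * ((2:ℝ)^k) ^ (-m)) := by gcongr
        _ = 2 ^ |s + m| * A * (((2:ℝ)^k) ^ (s + m) * ((2:ℝ)^k) ^ (-m)) := by ring
        _ = _ := by rw [h7]
    calc _ ≤ ENNReal.ofReal ((2:ℝ) ^ ((s + m) * ((j:ℝ) + 1))) *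
          (ENNReal.ofReal (A * ((2:ℝ)^k) ^ (-m)) * lpNormFun d p (fun x => (H k x : ℂ))) := by
          rw [ENNReal_two_rpow]
          gcongr
      _ = ENNReal.ofReal ((2:ℝ) ^ ((s + m) * ((j:ℝ) + 1)) * (A * ((2:ℝ)^k) ^ (-m))) *
          lpNormFun d p (fun x => (H k x : ℂ)) := by
          rw [← mul_assoc, ← ENNReal.ofReal_mul (by positivity)]
      _ ≤ ENNReal.ofReal (2 ^ |s + m| * A * ((2:ℝ)^k) ^ s) *
          lpNormFun d p (fun x => (H k x : ℂ)) := by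
          gcongr
      _ = ENNReal.ofReal (2 ^ |s + m| * A) * (ENNReal.ofReal (((2:ℝ)^k) ^ s) *
          lpNormFun d p (fun x => (H k x : ℂ))) := by
          rw [← mul_assoc, ← ENNReal.ofReal_mul (by positivity)]
      _ ≤ _ := by
          gcongr
          exact hB k hk
  · intro j hj
    rw [hfar (j+1), mul_zero]
    intro k hk
    by_contra hcon
    apply hj
    rw [Finset.mem_biUnion]
    refine ⟨k, hk, ?_⟩
    simp only [Finset.mem_insert, Finset.mem_singleton]
    have := hS2 k hk
    omega

lemma eventually_natCast_rpow_mul_lt {θ η : ℝ} (hθ : 0 ≤ θ) (h : θ < η) {X b : ℝ≥0∞}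
    (hX : X ≠ ⊤) (hb : b ≠ 0) : ∀ᶠ n : ℕ in atTop, (n : ℝ≥0∞) ^ θ * X < (n : ℝ≥0∞) ^ η * b := by
  have h1 : Tendsto (fun n : ℕ => (n : ℝ≥0∞) ^ (η - θ)) atTop (nhds ⊤) :=
    (ENNReal.tendsto_rpow_at_top (sub_pos.2 h)).comp ENNReal.tendsto_nat_nhds_top
  have h2 := ENNReal.Tendsto.mul_const (b := b) h1 (Or.inl ENNReal.top_ne_zero)
  rw [ENNReal.top_mul hb] at h2
  filter_upwards [h2.eventually_const_lt hX.lt_top, eventually_gt_atTop 0] with n hn hn0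
  have hn1 : (n : ℝ≥0∞) ≠ 0 := by exact_mod_cast hn0.ne'
  have hn2 : (n : ℝ≥0∞) ≠ ⊤ := ENNReal.natCast_ne_top n
  have h3 : (n : ℝ≥0∞) ^ η = (n : ℝ≥0∞) ^ θ * (n : ℝ≥0∞) ^ (η - θ) := by
    rw [← ENNReal.rpow_add _ _ hn1 hn2]
    ring_nf
  rw [h3, mul_assoc]
  exact ENNReal.mul_lt_mul_right (ENNReal.rpow_pos (pos_iff_ne_zero.2 hn1) hn2).ne'
    (ENNReal.rpow_ne_top_of_nonneg hθ hn2) hn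

section

variable {d : ℕ} {m : ℝ} {e : RD d} {ψ : RD d → ℝ}

/-- Unboundedness from many functions with the same low-frequency part, for `1 < q`. -/
lemma exists_mul_BesovNorm_lt_of_low_frequency (D : LPData d) (he : ‖e‖ = 1)
    (hone : ∀ ξ, ‖ξ - e‖ ≤ 1 / 20 → ψ ξ = 1)
    (hs : ∀ ξ, ψ ξ ≠ 0 → 9 / 10 ≤ ‖ξ‖ ∧ ‖ξ‖ ≤ 11 / 10) {p q : ℝ≥0∞} (hp : 0 < p) (hq : 1 < q)
    (s : ℝ) (k₀ K : ℕ) (G : ℕ → 𝓢(RD d, ℂ)) (H : ℕ → RD d → ℝ) {B : ℝ≥0∞} (hB : B ≠ ⊤)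
    (P : RD d → ℂ) (hP : lpNormFun d p P ≠ 0)
    (hG : ∀ k, ∀ ξ, fourierS (G k) ξ ≠ 0 → ‖ξ‖ ≤ 2 ^ k / 20)
    (hH : ∀ k, ∀ x, ‖G k x‖ ≤ H k x)
    (hslow : ∀ k, ∀ x y, H k (x - y) ≤ H k x * (1 + 2 ^ k * ‖y‖) ^ K)
    (hHB : ∀ k, ENNReal.ofReal (((2:ℝ) ^ k) ^ s) * lpNormFun d p (fun x => (H k x : ℂ)) ≤ B)
    (hGP : ∀ k ≥ k₀, ∀ x, LP D 0 (G k) x = P x) (C : ℝ≥0) :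
    ∃ f : 𝓢(RD d, ℂ), (C : ℝ≥0∞) * BesovNorm D (s + m) p q (⇑f) <
      BesovNorm D s p q (pdo (shiftSymbol m e ψ) f) := by
  obtain ⟨A, hA, hup⟩ := exists_BesovNorm_sum_liftS_le D K s m hp (zero_lt_one.trans hq) he
  have hθ : 1 / q.toReal < 1 := by
    rcases eq_or_ne q ⊤ with rfl | hqt
    · simp
    · have : 1 < q.toReal := by
        rw [← ENNReal.toReal_one]
        exact (ENNReal.toReal_lt_toReal ENNReal.one_ne_top hqt).2 hq
      rw [div_lt_one (by linarith)]
      exact this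
  have hθ0 : 0 ≤ 1 / q.toReal := by positivity
  have hX : (C : ℝ≥0∞) * ((3:ℝ≥0∞) ^ (1 / q.toReal) * (ENNReal.ofReal A * B)) ≠ ⊤ := by
    finiteness
  obtain ⟨n, hn, hn0⟩ := ((eventually_natCast_rpow_mul_lt hθ0 hθ hX hP).and
    (eventually_gt_atTop 0)).exists
  set S : Finset ℕ := (Finset.range n).image fun i => k₀ + 2 + 3 * i with hS
  have hScard : S.card = n := by
    rw [hS, Finset.card_image_of_injective _ fun a b hab => ?_, Finset.card_range]
    simpa using hab
  have hSge : ∀ k ∈ S, k₀ + 2 ≤ k := fun k hk => by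
    obtain ⟨i, -, rfl⟩ := Finset.mem_image.1 hk
    omega
  have hSsep : ∀ k ∈ S, ∀ l ∈ S, k ≠ l → k + 3 ≤ l ∨ l + 3 ≤ k := fun k hk l hl hkl => by
    obtain ⟨i, -, rfl⟩ := Finset.mem_image.1 hk
    obtain ⟨j, -, rfl⟩ := Finset.mem_image.1 hl
    omega
  refine ⟨∑ k ∈ S, liftS m e k (G k), ?_⟩
  have hub := hup S G H B (fun k hk => by have := hSge k hk; omega) hSsep (fun k _ => hG k)
    (fun k _ => hH k) (fun k _ => hslow k) (fun k _ => hHB k)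
  have hpdo : pdo (shiftSymbol m e ψ) (∑ k ∈ S, liftS m e k (G k)) = ⇑(∑ k ∈ S, G k) := by
    funext x
    rw [pdo_shiftSymbol_sum_liftS hone hs S G (fun k _ => hG k), _root_.sum_apply]
  have hlow : LP D 0 (⇑(∑ k ∈ S, G k)) = fun x => (((n : ℕ) : ℝ) : ℂ) * P x := by
    funext x
    rw [LP_sum, Finset.sum_congr rfl fun k hk => hGP k (by have := hSge k hk; omega) x,
      Finset.sum_const, hScard, nsmul_eq_mul, Complex.ofReal_natCast]
  have hlb : (n : ℝ≥0∞) * lpNormFun d p P ≤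
      BesovNorm D s p q (pdo (shiftSymbol m e ψ) (∑ k ∈ S, liftS m e k (G k))) := by
    rw [hpdo]
    refine le_trans (le_of_eq ?_) (lpNormFun_LP_zero_le_BesovNorm D s p q _)
    rw [hlow, lpNormFun_const_mul hp P (by exact_mod_cast hn0), ENNReal.ofReal_natCast]
  refine lt_of_lt_of_le ?_ hlb
  rw [ENNReal.rpow_one] at hn
  refine lt_of_le_of_lt ?_ hn
  rw [hScard] at hub
  calc _ ≤ (C : ℝ≥0∞) * (((3 * n : ℕ) : ℝ≥0∞) ^ (1 / q.toReal) * (ENNReal.ofReal A * B)) := by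
        gcongr
    _ = _ := by
        push_cast
        rw [ENNReal.mul_rpow_of_nonneg _ _ hθ0]
        ring

/-- Unboundedness from one function at a time, with `n` comparable Littlewood–Paley blocks. -/
lemma exists_mul_BesovNorm_lt_of_many_blocks (D : LPData d) (he : ‖e‖ = 1)
    (hone : ∀ ξ, ‖ξ - e‖ ≤ 1 / 20 → ψ ξ = 1)
    (hs : ∀ ξ, ψ ξ ≠ 0 → 9 / 10 ≤ ‖ξ‖ ∧ ‖ξ‖ ≤ 11 / 10) {p q : ℝ≥0∞} (hp : 0 < p) (hq : 0 < q)
    (hqt : q ≠ ⊤) (s : ℝ) (K : ℕ) {θ : ℝ} (hθ0 : 0 ≤ θ) (hθ : θ < 1 / q.toReal)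
    (M : ℕ → ℕ) (U : ℕ → Finset ℕ) (G : ℕ → 𝓢(RD d, ℂ)) (H : ℕ → RD d → ℝ) (β : ℕ → ℝ)
    {X b : ℝ≥0∞} (hX : X ≠ ⊤) (hb : b ≠ 0) (hβ : ∀ n, 0 < β n)
    (hM : ∀ n, 2 ≤ M n) (hU : ∀ n, (U n).card = n)
    (hG : ∀ n, ∀ ξ, fourierS (G n) ξ ≠ 0 → ‖ξ‖ ≤ 2 ^ M n / 20)
    (hH : ∀ n, ∀ x, ‖G n x‖ ≤ H n x)
    (hslow : ∀ n, ∀ x y, H n (x - y) ≤ H n x * (1 + 2 ^ M n * ‖y‖) ^ K)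
    (hHX : ∀ n, 0 < n → ENNReal.ofReal (((2:ℝ) ^ M n) ^ s) * lpNormFun d p (fun x => (H n x : ℂ)) ≤
      ENNReal.ofReal (β n) * ((n : ℝ≥0∞) ^ θ * X))
    (hlow : ∀ n, ∀ j ∈ U n, ENNReal.ofReal (β n) * b ≤
      (2:ℝ≥0∞)^(s*((j:ℝ)+1)) * lpNormFun d p (LP D (j+1) (G n))) (C : ℝ≥0) :
    ∃ f : 𝓢(RD d, ℂ), (C : ℝ≥0∞) * BesovNorm D (s + m) p q (⇑f) <
      BesovNorm D s p q (pdo (shiftSymbol m e ψ) f) := by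
  obtain ⟨A, hA, hup⟩ := exists_BesovNorm_sum_liftS_le D K s m hp hq he
  have hX' : (C : ℝ≥0∞) * ((3:ℝ≥0∞) ^ (1 / q.toReal) * (ENNReal.ofReal A * X)) ≠ ⊤ := by
    finiteness
  obtain ⟨n, hn, hn0⟩ := ((eventually_natCast_rpow_mul_lt hθ0 hθ hX' hb).and
    (eventually_gt_atTop 0)).exists
  refine ⟨∑ k ∈ {M n}, liftS m e k (G n), ?_⟩
  have hub := hup {M n} (fun _ => G n) (fun _ => H n) _ (by simpa using hM n)
    (by simp) (by simpa using hG n) (by simpa using hH n) (by simpa using hslow n)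
    (by simpa only [Finset.mem_singleton, forall_eq] using hHX n hn0)
  have hpdo : pdo (shiftSymbol m e ψ) (∑ k ∈ {M n}, liftS m e k (G n)) = ⇑(G n) := by
    funext x
    rw [pdo_shiftSymbol_sum_liftS hone hs {M n} (fun _ => G n) (by simpa using hG n),
      Finset.sum_singleton]
  have hlb := card_rpow_mul_le_BesovNorm D s p hq hqt (G n) (U n) _ (hlow n)
  rw [hU] at hlb
  rw [hpdo]
  refine lt_of_lt_of_le ?_ hlb
  have hβ0 : ENNReal.ofReal (β n) ≠ 0 := by simpa using hβ n
  calc _ ≤ (C : ℝ≥0∞) * (((3 * 1 : ℕ) : ℝ≥0∞) ^ (1 / q.toReal) *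
        (ENNReal.ofReal A * (ENNReal.ofReal (β n) * ((n : ℝ≥0∞) ^ θ * X)))) := by
        rw [Finset.card_singleton] at hub
        gcongr
    _ = ENNReal.ofReal (β n) * ((n : ℝ≥0∞) ^ θ *
        ((C : ℝ≥0∞) * ((3:ℝ≥0∞) ^ (1 / q.toReal) * (ENNReal.ofReal A * X)))) := by
        push_cast
        ring
    _ < ENNReal.ofReal (β n) * ((n : ℝ≥0∞) ^ (1 / q.toReal) * b) :=
        ENNReal.mul_lt_mul_right hβ0 ENNReal.ofReal_ne_top hn
    _ = _ := by ring

end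

/-- A Schwartz function whose Fourier transform is a bump function at the origin. -/
lemma exists_fourierS_bump (d : ℕ) : ∃ g : 𝓢(RD d, ℂ),
    (∀ ξ, ‖ξ‖ ≤ 1 / 40 → fourierS g ξ = 1) ∧ (∀ ξ, fourierS g ξ ≠ 0 → ‖ξ‖ ≤ 1 / 20) ∧
      g 0 ≠ 0 := by
  let χ : ContDiffBump (0 : RD d) := ⟨1 / 40, 1 / 20, by norm_num, by norm_num⟩
  have hc : HasCompactSupport (fun ξ => ((χ ξ : ℝ) : ℂ)) :=
    χ.hasCompactSupport.comp_left Complex.ofReal_zero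
  have hsm : ContDiff ℝ ∞ (fun ξ => ((χ ξ : ℝ) : ℂ)) := Complex.ofRealCLM.contDiff.comp χ.contDiff
  have hg : ∀ ξ, fourierS (invS (hc.toSchwartzMap hsm)) ξ = ((χ ξ : ℝ) : ℂ) := fun ξ => by
    rw [fourierS_invS]
    rfl
  refine ⟨invS (hc.toSchwartzMap hsm), fun ξ hξ => ?_, fun ξ hξ => ?_, ?_⟩
  · rw [hg, χ.one_of_mem_closedBall (mem_closedBall_zero_iff.2 hξ), Complex.ofReal_one]
  · rw [hg] at hξ
    have : ξ ∈ Function.support χ := fun h => hξ (by rw [h, Complex.ofReal_zero])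
    rw [χ.support_eq] at this
    exact (mem_ball_zero_iff.1 this).le
  · rw [invS_apply]
    have : ∀ ξ : RD d, hc.toSchwartzMap hsm ξ * unitChar ⟪(0 : RD d), ξ⟫ = ((χ ξ : ℝ) : ℂ) :=
      fun ξ => by
        rw [inner_zero_left]
        simp [unitChar]
    simp only [this]
    rw [integral_complex_ofReal]
    exact_mod_cast χ.integral_pos.ne'

lemma exists_norm_le_decay {d : ℕ} (g : 𝓢(RD d, ℂ)) (K : ℕ) :
    ∃ C : ℝ, 0 < C ∧ ∀ x, ‖g x‖ ≤ C * ((1 + ‖x‖) ^ K)⁻¹ := by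
  have h := fun x => SchwartzMap.one_add_le_sup_seminorm_apply (𝕜 := ℝ) (m := (K, 0))
    (k := K) (n := 0) le_rfl le_rfl g x
  simp only [norm_iteratedFDeriv_zero] at h
  refine ⟨2 ^ K * ((Finset.Iic (K, 0)).sup fun m => SchwartzMap.seminorm ℝ m.1 m.2) g + 1,
    by positivity, fun x => ?_⟩
  rw [← div_eq_mul_inv, le_div_iff₀ (by positivity), mul_comm]
  exact (h x).trans (by linarith)

lemma decay_slowly_varying {d : ℕ} (K : ℕ) {R : ℝ} (hR : 1 ≤ R) (x y : RD d) :
    ((1 + ‖x - y‖) ^ K)⁻¹ ≤ ((1 + ‖x‖) ^ K)⁻¹ * (1 + R * ‖y‖) ^ K := by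
  rw [← div_eq_inv_mul, le_div_iff₀ (by positivity), ← div_eq_inv_mul, div_le_iff₀ (by positivity),
    ← mul_pow]
  gcongr
  have h1 : ‖x‖ ≤ ‖x - y‖ + ‖y‖ := by simpa using norm_add_le (x - y) y
  have h2 : ‖y‖ ≤ R * ‖y‖ := le_mul_of_one_le_left (norm_nonneg _) hR
  nlinarith [norm_nonneg y, norm_nonneg (x - y),
    mul_nonneg (norm_nonneg (x - y)) (h2.trans' (norm_nonneg y))]

lemma lpNormFun_decay_ne_top {d : ℕ} {p : ℝ≥0∞} (hp : 0 < p) (hpt : p ≠ ⊤) {K : ℕ}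
    (hK : (d : ℝ) < K * p.toReal) (C : ℝ) :
    lpNormFun d p (fun x => ((C * ((1 + ‖x‖) ^ K)⁻¹ : ℝ) : ℂ)) ≠ ⊤ := by
  have hp0 : 0 < p.toReal := ENNReal.toReal_pos hp.ne' hpt
  have h1 : lpNormFun d p (fun x => ((((1 + ‖x‖) ^ K)⁻¹ : ℝ) : ℂ)) ≠ ⊤ := by
    rw [lpNormFun, if_neg hpt]
    have h := finite_integral_one_add_norm (μ := (volume : Measure (RD d)))
      (r := K * p.toReal) (by simpa using hK)
    refine ENNReal.rpow_ne_top_of_nonneg (by positivity) (ne_of_eq_of_ne ?_ h.ne)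
    refine lintegral_congr fun x => ?_
    change ‖((((1 + ‖x‖) ^ K)⁻¹ : ℝ) : ℂ)‖ₑ ^ _ = _
    rw [← ofReal_norm, ENNReal.ofReal_rpow_of_nonneg (norm_nonneg _) hp0.le, Complex.norm_real,
      Real.norm_of_nonneg (by positivity), Real.rpow_neg (by positivity), Real.rpow_mul
      (by positivity), Real.rpow_natCast, Real.inv_rpow (by positivity)]
  have h2 := lpNormFun_le_mul (d := d) hp (abs_nonneg C)
    (g := fun x => ((C * ((1 + ‖x‖) ^ K)⁻¹ : ℝ) : ℂ))
    (h := fun x => ((((1 + ‖x‖) ^ K)⁻¹ : ℝ) : ℂ)) (fun x => by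
      rw [Complex.ofReal_mul, norm_mul, Complex.norm_real, Real.norm_eq_abs])
  exact ne_top_of_le_ne_top (ENNReal.mul_ne_top ENNReal.ofReal_ne_top h1) h2

lemma exists_ne_zero_of_fourierS_ne_zero {d : ℕ} {f : 𝓢(RD d, ℂ)} {ξ : RD d}
    (h : fourierS f ξ ≠ 0) : ∃ x, f x ≠ 0 := by
  by_contra! hf
  apply h
  simp [fourierS_apply, hf]

lemma LP_dilS_eq_LPkernel {d : ℕ} (D : LPData d) {g : 𝓢(RD d, ℂ)}
    (hg : ∀ ξ, ‖ξ‖ ≤ 1 / 40 → fourierS g ξ = 1) {j k : ℕ} (hjk : j + 7 ≤ k) (x : RD d) :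
    LP D j (dilS ((2:ℝ)^k) (by positivity) g) x = LPkernel D j x := by
  refine LP_eq_LPkernel D j _ (fun ξ hξ => ?_) x
  rw [fourierS_dilS]
  apply hg
  have h1 : ‖ξ‖ ≤ 2 ^ (j + 1) := not_lt.1 fun h => hξ (LPhat_eq_zero_of_lt_norm D j h)
  have h2 : (2:ℝ) ^ (j + 1 + 6) ≤ 2 ^ k := pow_le_pow_right₀ (by norm_num) (by omega)
  rw [pow_add] at h2
  rw [norm_smul, norm_inv, norm_pow, Real.norm_ofNat, inv_mul_le_iff₀ (by positivity)]
  have : (0:ℝ) < 2 ^ (j + 1) := by positivity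
  linarith

lemma lpNormFun_LPkernel_succ {d : ℕ} (D : LPData d) {p : ℝ≥0∞} (hp : 0 < p) (hpt : p ≠ ⊤)
    (j : ℕ) : lpNormFun d p (LPkernel D (j+1)) =
      ENNReal.ofReal (((2:ℝ)^(j+1)) ^ ((d : ℝ) - d / p.toReal)) * lpNormFun d p D.φ := by
  rw [← lpNormFun_dilation hp hpt D.φ.continuous (by positivity)]
  congr 1
  funext x
  rw [LPkernel, pow_mul]

section

variable {d : ℕ} {m : ℝ} {e : RD d} {ψ : RD d → ℝ}

lemma exists_mul_BesovNorm_lt_of_le_one (hd : 1 ≤ d) (D : LPData d) (he : ‖e‖ = 1)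
    (hone : ∀ ξ, ‖ξ - e‖ ≤ 1 / 20 → ψ ξ = 1)
    (hs : ∀ ξ, ψ ξ ≠ 0 → 9 / 10 ≤ ‖ξ‖ ∧ ‖ξ‖ ≤ 11 / 10) {p q : ℝ≥0∞} (hp : 0 < p) (hp1 : p ≤ 1)
    (hq : 0 < q) {s : ℝ} (hsp : s ≤ d / p.toReal - d) (C : ℝ≥0) :
    ∃ f : 𝓢(RD d, ℂ), (C : ℝ≥0∞) * BesovNorm D (s + m) p q (⇑f) <
      BesovNorm D s p q (pdo (shiftSymbol m e ψ) f) := by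
  have hpt : p ≠ ⊤ := ne_top_of_le_ne_top ENNReal.one_ne_top hp1
  have hp0 : 0 < p.toReal := ENNReal.toReal_pos hp.ne' hpt
  obtain ⟨K, hK⟩ := exists_nat_gt ((d : ℝ) / p.toReal)
  rw [div_lt_iff₀ hp0] at hK
  obtain ⟨g, hg1, hg0, -⟩ := exists_fourierS_bump d
  obtain ⟨c, hc, hgc⟩ := exists_norm_le_decay g K
  set W : RD d → ℝ := fun x => c * ((1 + ‖x‖) ^ K)⁻¹ with hW
  have hWfin : lpNormFun d p (fun x => (W x : ℂ)) ≠ ⊤ := lpNormFun_decay_ne_top hp hpt hK c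
  have hWc : Continuous fun x => (W x : ℂ) :=
    Complex.continuous_ofReal.comp (continuous_const.mul
      (Continuous.inv₀ (by fun_prop) fun x => by positivity))
  set G : ℕ → 𝓢(RD d, ℂ) := fun k => dilS ((2:ℝ)^k) (by positivity) g with hGdef
  set H : ℕ → RD d → ℝ := fun k x => ((2:ℝ)^k) ^ d * W ((2:ℝ)^k • x) with hHdef
  have hG : ∀ k ξ, fourierS (G k) ξ ≠ 0 → ‖ξ‖ ≤ 2 ^ k / 20 := fun k ξ hξ => by
    rw [fourierS_dilS] at hξ
    have := hg0 _ hξ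
    rw [norm_smul, norm_inv, norm_pow, Real.norm_ofNat, inv_mul_le_iff₀ (by positivity)] at this
    linarith
  have hH : ∀ k x, ‖G k x‖ ≤ H k x := fun k x => by
    rw [hGdef]
    simp only
    rw [dilS_apply _ (by positivity), norm_mul, Complex.norm_real,
      Real.norm_of_nonneg (by positivity)]
    exact mul_le_mul_of_nonneg_left (hgc _) (by positivity)
  have hslow : ∀ k x y, H k (x - y) ≤ H k x * (1 + 2 ^ k * ‖y‖) ^ K := fun k x y => by
    have h := decay_slowly_varying K le_rfl ((2:ℝ)^k • x) ((2:ℝ)^k • y)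
    rw [← smul_sub, one_mul, norm_smul _ y, norm_pow, Real.norm_ofNat] at h
    simp only [hHdef, hW]
    rw [mul_assoc, mul_assoc]
    gcongr
  have hnorm : ∀ k, ENNReal.ofReal (((2:ℝ) ^ k) ^ s) * lpNormFun d p (fun x => (H k x : ℂ)) =
      ENNReal.ofReal (((2:ℝ) ^ k) ^ (s - (d / p.toReal - d))) *
        lpNormFun d p (fun x => (W x : ℂ)) := fun k => by
    have h := lpNormFun_dilation hp hpt hWc (r := (2:ℝ)^k) (by positivity)
    simp only [hHdef, Complex.ofReal_mul]
    rw [h, ← mul_assoc, ← ENNReal.ofReal_mul (by positivity), ← Real.rpow_add (by positivity)]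
    ring_nf
  rcases lt_or_ge 1 q with hq1 | hq1
  · obtain ⟨x₀, hx₀⟩ := exists_ne_zero_of_fourierS_ne_zero (f := D.Φ) (ξ := 0) (by
      have : fourierS D.Φ 0 = 1 := LPhat_zero_eq_one D (by simp)
      rw [this]
      exact one_ne_zero)
    refine exists_mul_BesovNorm_lt_of_low_frequency D he hone hs hp hq1 s 7 K G H hWfin D.Φ
      (lpNormFun_pos hp D.Φ.continuous hx₀).ne' hG hH hslow (fun k => ?_) (fun k hk x => ?_) C
    · rw [hnorm]
      refine mul_le_of_le_one_left (zero_le) (ENNReal.ofReal_le_one.2 ?_)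
      exact Real.rpow_le_one_of_one_le_of_nonpos (one_le_pow₀ (by norm_num)) (by linarith)
    · exact LP_dilS_eq_LPkernel D hg1 (by omega) x
  · have hqt : q ≠ ⊤ := ne_top_of_le_ne_top ENNReal.one_ne_top hq1
    have hq0 : 0 < q.toReal := ENNReal.toReal_pos hq.ne' hqt
    obtain ⟨ξ₀, hξ₀⟩ := exists_fourierS_φ_ne_zero hd D
    obtain ⟨x₀, hx₀⟩ := exists_ne_zero_of_fourierS_ne_zero hξ₀
    refine exists_mul_BesovNorm_lt_of_many_blocks D he hone hs hp hq hqt s K le_rfl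
      (one_div_pos.2 hq0) (fun n => n + 7) Finset.range (fun n => G (n + 7)) (fun n => H (n + 7))
      (fun n => ((2:ℝ) ^ (n + 7)) ^ (s - (d / p.toReal - d))) hWfin
      (lpNormFun_pos hp D.φ.continuous hx₀).ne' (fun n => by positivity) (fun n => by omega)
      Finset.card_range (fun n => hG _) (fun n => hH _) (fun n => hslow _)
      (fun n _ => ?_) (fun n j hj => ?_) C
    · rw [hnorm, ENNReal.rpow_zero, one_mul]
    · have hj' := Finset.mem_range.1 hj
      have hfun : LP D (j+1) (G (n + 7)) = LPkernel D (j+1) :=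
        funext fun x => LP_dilS_eq_LPkernel D hg1 (by omega) x
      rw [hfun, lpNormFun_LPkernel_succ D hp hpt, ← mul_assoc, ENNReal_two_rpow,
        ← ENNReal.ofReal_mul (by positivity)]
      gcongr
      have h1 : (2:ℝ) ^ (s * ((j:ℝ) + 1)) = ((2:ℝ)^(j+1)) ^ s := by
        rw [← Real.rpow_natCast, ← Real.rpow_mul (by norm_num), mul_comm]
        push_cast
        rfl
      rw [h1, ← Real.rpow_add (by positivity)]
      have h2 : s + ((d:ℝ) - d / p.toReal) = s - (d / p.toReal - d) := by ring
      rw [h2]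
      exact Real.rpow_le_rpow_of_nonpos (by positivity)
        (pow_le_pow_right₀ (by norm_num) (by omega)) (by linarith)

end

lemma exists_sum_inv_one_add_abs_sq_le :
    ∃ Γ : ℝ, 0 < Γ ∧ ∀ (t : ℝ) (n : ℕ), ∑ i ∈ Finset.range n, ((1 + |t - i|) ^ 2)⁻¹ ≤ Γ := by
  have hnat : Summable fun j : ℕ => ((1 + (j:ℝ)) ^ 2)⁻¹ := by
    have h := (summable_nat_add_iff 1).2 (Real.summable_nat_pow_inv.2 (one_lt_two : 1 < 2))
    refine h.congr fun j => ?_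
    push_cast
    rw [add_comm]
  have hsum : Summable fun j : ℤ => ((1 + |(j:ℝ)|) ^ 2)⁻¹ := by
    refine Summable.of_nat_of_neg ?_ ?_
    · simpa using hnat
    · simpa using hnat
  refine ⟨4 * ∑' j : ℤ, ((1 + |(j:ℝ)|) ^ 2)⁻¹ + 1, by positivity, fun t n => ?_⟩
  have hterm : ∀ i : ℕ, ((1 + |t - i|) ^ 2)⁻¹ ≤
      4 * ((1 + |((⌊t⌋ - (i:ℤ) : ℤ) : ℝ)|) ^ 2)⁻¹ := fun i => by
    rw [← div_eq_mul_inv, le_div_iff₀ (by positivity), ← div_eq_inv_mul,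
      div_le_iff₀ (by positivity)]
    have h1 : |((⌊t⌋ - (i:ℤ) : ℤ) : ℝ)| ≤ |t - i| + 1 := by
      push_cast
      have h2 : |(⌊t⌋:ℝ) - t| ≤ 1 := by
        rw [abs_le]
        constructor <;> linarith [Int.floor_le t, Int.lt_floor_add_one t]
      calc |(⌊t⌋:ℝ) - i| = |(t - i) + (⌊t⌋ - t)| := by ring_nf
        _ ≤ |t - i| + |(⌊t⌋:ℝ) - t| := abs_add_le _ _
        _ ≤ _ := by gcongr
    calc (1 + |((⌊t⌋ - (i:ℤ) : ℤ) : ℝ)|) ^ 2 ≤ (2 * (1 + |t - i|)) ^ 2 := by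
          gcongr
          linarith [abs_nonneg (t - i)]
      _ = _ := by ring
  have hinj : Function.Injective fun i : ℕ => ⌊t⌋ - (i:ℤ) := fun a b hab => by simpa using hab
  calc ∑ i ∈ Finset.range n, ((1 + |t - i|) ^ 2)⁻¹
      ≤ ∑ i ∈ Finset.range n, 4 * ((1 + |((⌊t⌋ - (i:ℤ) : ℤ) : ℝ)|) ^ 2)⁻¹ :=
        Finset.sum_le_sum fun i _ => hterm i
    _ = 4 * ∑ j ∈ (Finset.range n).image (fun i : ℕ => ⌊t⌋ - (i:ℤ)), ((1 + |(j:ℝ)|) ^ 2)⁻¹ := by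
        rw [← Finset.mul_sum, Finset.sum_image fun a _ b _ hab => hinj hab]
    _ ≤ 4 * ∑' j : ℤ, ((1 + |(j:ℝ)|) ^ 2)⁻¹ := by
        gcongr
        exact hsum.sum_le_tsum _ fun j _ => by positivity
    _ ≤ _ := by linarith

/-- A sum of `n` separated decaying functions has `L^p` norm of order `n^{1/p}`. -/
lemma exists_lpNormFun_sum_translate_le {d : ℕ} (hd : 1 ≤ d) {p : ℝ≥0∞} (hp : 1 < p) {e : RD d}
    (he : ‖e‖ = 1) :
    ∃ X : ℝ≥0∞, X ≠ ⊤ ∧ ∀ n : ℕ, lpNormFun d p (fun x =>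
      ((∑ i ∈ Finset.range n, ((1 + ‖x - (i:ℝ) • e‖) ^ (d + 1))⁻¹ : ℝ) : ℂ)) ≤
        (n : ℝ≥0∞) ^ (1 / p.toReal) * X := by
  obtain ⟨Γ, hΓ, hΓsum⟩ := exists_sum_inv_one_add_abs_sq_le
  set N : ℕ → RD d → ℝ := fun n x => ∑ i ∈ Finset.range n, ((1 + ‖x - (i:ℝ) • e‖) ^ (d + 1))⁻¹
    with hN
  have hN0 : ∀ n x, 0 ≤ N n x := fun n x => Finset.sum_nonneg fun i _ => by positivity
  have hNΓ : ∀ n x, N n x ≤ Γ := fun n x => by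
    refine le_trans (Finset.sum_le_sum fun i _ => ?_) (hΓsum ⟪x, e⟫ n)
    have h1 : |⟪x, e⟫ - i| ≤ ‖x - (i:ℝ) • e‖ := by
      have h2 : ⟪x - (i:ℝ) • e, e⟫ = ⟪x, e⟫ - i := by
        rw [inner_sub_left, inner_smul_left, real_inner_self_eq_norm_sq, he]
        simp
      rw [← h2]
      simpa [he] using abs_real_inner_le_norm (x - (i:ℝ) • e) e
    gcongr ?_⁻¹
    calc (1 + |⟪x, e⟫ - i|) ^ 2 ≤ (1 + ‖x - (i:ℝ) • e‖) ^ 2 := by gcongr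
      _ ≤ (1 + ‖x - (i:ℝ) • e‖) ^ (d + 1) :=
        pow_le_pow_right₀ (by linarith [norm_nonneg (x - (i:ℝ) • e)]) (by omega)
  have henorm : ∀ n x, (‖((N n x : ℝ) : ℂ)‖₊ : ℝ≥0∞) = ENNReal.ofReal (N n x) := fun n x => by
    change ‖((N n x : ℝ) : ℂ)‖ₑ = _
    rw [← ofReal_norm, Complex.norm_real, Real.norm_of_nonneg (hN0 n x)]
  rcases eq_or_ne p ⊤ with rfl | hpt
  · refine ⟨ENNReal.ofReal Γ, ENNReal.ofReal_ne_top, fun n => ?_⟩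
    rw [lpNormFun, if_pos rfl, ENNReal.toReal_top, div_zero, ENNReal.rpow_zero, one_mul]
    refine iSup_le fun x => ?_
    rw [henorm]
    exact ENNReal.ofReal_le_ofReal (hNΓ n x)
  · have hp1 : 1 < p.toReal := by
      rw [← ENNReal.toReal_one]
      exact (ENNReal.toReal_lt_toReal ENNReal.one_ne_top hpt).2 hp
    set I : ℝ≥0∞ := ∫⁻ x : RD d, ENNReal.ofReal ((1 + ‖x‖) ^ (d + 1))⁻¹ with hI
    have hIfin : I ≠ ⊤ := by
      have h := finite_integral_one_add_norm (μ := (volume : Measure (RD d)))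
        (r := ((d + 1 : ℕ) : ℝ)) (by simp)
      refine ne_of_eq_of_ne (lintegral_congr fun x => ?_) h.ne
      rw [Real.rpow_neg (by positivity), Real.rpow_natCast]
    have hInt : ∀ n, ∫⁻ x, ENNReal.ofReal (N n x) = n * I := fun n => by
      have h1 : ∀ x, ENNReal.ofReal (N n x) = ∑ i ∈ Finset.range n,
          ENNReal.ofReal ((1 + ‖x - (i:ℝ) • e‖) ^ (d + 1))⁻¹ := fun x =>
        ENNReal.ofReal_sum_of_nonneg fun i _ => by positivity
      simp only [h1]
      rw [lintegral_finsetSum _ fun i _ => by fun_prop]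
      rw [Finset.sum_congr rfl fun (i : ℕ) _ => lintegral_sub_right_eq_self
        (fun x : RD d => ENNReal.ofReal ((1 + ‖x‖) ^ (d + 1))⁻¹) ((i:ℝ) • e)]
      rw [Finset.sum_const, Finset.card_range, nsmul_eq_mul]
    refine ⟨(ENNReal.ofReal (Γ ^ (p.toReal - 1)) * I) ^ (1 / p.toReal),
      ENNReal.rpow_ne_top_of_nonneg (by positivity)
        (ENNReal.mul_ne_top ENNReal.ofReal_ne_top hIfin), fun n => ?_⟩
    rw [lpNormFun, if_neg hpt, ← ENNReal.mul_rpow_of_nonneg _ _ (by positivity)]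
    refine ENNReal.rpow_le_rpow ?_ (by positivity)
    calc ∫⁻ x, (‖((N n x : ℝ) : ℂ)‖₊ : ℝ≥0∞) ^ p.toReal
        ≤ ∫⁻ x, ENNReal.ofReal (Γ ^ (p.toReal - 1)) * ENNReal.ofReal (N n x) := by
          refine lintegral_mono fun x => ?_
          rw [henorm, ENNReal.ofReal_rpow_of_nonneg (hN0 n x) (by linarith),
            ← ENNReal.ofReal_mul (by positivity)]
          refine ENNReal.ofReal_le_ofReal ?_
          calc N n x ^ p.toReal = N n x ^ (p.toReal - 1) * N n x := by
                rw [← Real.rpow_add_one' (hN0 n x) (by linarith)]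
                ring_nf
            _ ≤ _ := by
                exact mul_le_mul_of_nonneg_right
                  (Real.rpow_le_rpow (hN0 n x) (hNΓ n x) (by linarith)) (hN0 n x)
      _ = n * (ENNReal.ofReal (Γ ^ (p.toReal - 1)) * I) := by
          rw [lintegral_const_mul' _ _ ENNReal.ofReal_ne_top, hInt]
          ring

/-- A translate of `g`, moved in frequency by `w`. -/
def wavePacket {d : ℕ} (g : 𝓢(RD d, ℂ)) (v w : RD d) : 𝓢(RD d, ℂ) :=
  modS w (SchwartzMap.compSubConstCLM ℂ v g)

lemma fourierS_wavePacket {d : ℕ} (g : 𝓢(RD d, ℂ)) (v w ξ : RD d) :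
    fourierS (wavePacket g v w) ξ = unitChar (-⟪v, ξ - w⟫) * fourierS g (ξ - w) := by
  rw [wavePacket, fourierS_modS, fourierS_translate]

lemma norm_wavePacket_apply {d : ℕ} (g : 𝓢(RD d, ℂ)) (v w x : RD d) :
    ‖wavePacket g v w x‖ = ‖g (x - v)‖ := by
  rw [wavePacket, modS_apply, norm_mul, norm_unitChar, one_mul, SchwartzMap.compSubConstCLM_apply]

lemma LP_succ_wavePacket {d : ℕ} (D : LPData d) (k : ℕ) (g : 𝓢(RD d, ℂ)) (v ζ x : RD d) :
    LP D (k+1) (wavePacket g v ((2:ℝ)^(k+1) • ζ)) x =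
      unitChar ⟪x, (2:ℝ)^(k+1) • ζ⟫ *
        ∫ η, fourierS D.φ (ζ + ((2:ℝ)^(k+1))⁻¹ • η) * fourierS g η * unitChar ⟪x - v, η⟫ := by
  rw [LP_eq_integral_LPhat, ← integral_const_mul,
    ← integral_add_right_eq_self _ ((2:ℝ)^(k+1) • ζ)]
  refine integral_congr_ae (Eventually.of_forall fun η => ?_)
  simp only [fourierS_wavePacket, add_sub_cancel_right, LPhat]
  rw [smul_add, inv_smul_smul₀ (by positivity), inner_add_right, unitChar_add, inner_sub_left,
    sub_eq_add_neg, unitChar_add, add_comm ζ]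
  ring

lemma continuous_integral_fourierS_mul {d : ℕ} (f g : 𝓢(RD d, ℂ)) (ζ : RD d) :
    Continuous fun u : RD d × ℝ =>
      ∫ η, fourierS f (ζ + u.2 • η) * fourierS g η * unitChar ⟪u.1, η⟫ := by
  obtain ⟨c, -, hc⟩ := exists_norm_le_decay (fourierS f) 0
  simp only [pow_zero, inv_one, mul_one] at hc
  refine continuous_of_dominated (bound := fun η => c * ‖fourierS g η‖) (fun u => ?_)
    (fun u => Eventually.of_forall fun η => ?_) ((fourierS g).integrable.norm.const_mul c)
    (Eventually.of_forall fun η => ?_)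
  · refine Continuous.aestronglyMeasurable ?_
    exact (((fourierS f).continuous.comp (by fun_prop)).mul (fourierS g).continuous).mul
      (continuous_unitChar.comp (by fun_prop))
  · rw [norm_mul, norm_mul, norm_unitChar, mul_one]
    gcongr
    exact hc _
  · exact (((fourierS f).continuous.comp (by fun_prop)).mul continuous_const).mul
      (continuous_unitChar.comp (by fun_prop))

/-- Uniform lower bound for the Littlewood–Paley blocks of wave packets. -/
lemma exists_le_norm_LP_wavePacket {d : ℕ} (D : LPData d) {g : 𝓢(RD d, ℂ)} (hg : g 0 ≠ 0)
    {ζ : RD d} (hζ : fourierS D.φ ζ ≠ 0) :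
    ∃ c > 0, ∃ δ > 0, ∃ k₀ : ℕ, ∀ k ≥ k₀, ∀ v : RD d, ∀ x ∈ Metric.ball v δ,
      c ≤ ‖LP D (k+1) (wavePacket g v ((2:ℝ)^(k+1) • ζ)) x‖ := by
  set T : RD d × ℝ → ℂ := fun u =>
    ∫ η, fourierS D.φ (ζ + u.2 • η) * fourierS g η * unitChar ⟪u.1, η⟫ with hT
  have hT0 : T 0 = fourierS D.φ ζ * g 0 := by
    conv_rhs => rw [← invS_fourierS g]
    rw [invS_apply, ← integral_const_mul]
    simp only [hT, Prod.fst_zero, Prod.snd_zero, zero_smul, add_zero, mul_assoc]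
  have hpos : 0 < ‖T 0‖ := by
    rw [hT0]
    exact norm_pos_iff.2 (mul_ne_zero hζ hg)
  have hev : ∀ᶠ u in nhds (0 : RD d × ℝ), ‖T 0‖ / 2 < ‖T u‖ :=
    (continuous_integral_fourierS_mul D.φ g ζ).norm.continuousAt.eventually_const_lt
      (half_lt_self hpos)
  obtain ⟨δ, hδ, hball⟩ := Metric.eventually_nhds_iff_ball.1 hev
  obtain ⟨k₀, hk₀⟩ := exists_pow_lt_of_lt_one hδ (by norm_num : (1/2 : ℝ) < 1)
  refine ⟨‖T 0‖ / 2, half_pos hpos, δ, hδ, k₀, fun k hk v x hx => ?_⟩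
  rw [LP_succ_wavePacket, norm_mul, norm_unitChar, one_mul]
  refine (hball (x - v, ((2:ℝ)^(k+1))⁻¹) ?_).le
  rw [mem_ball_zero_iff, Prod.norm_def, max_lt_iff]
  refine ⟨by simpa [dist_eq_norm] using hx, ?_⟩
  rw [Real.norm_of_nonneg (by positivity)]
  refine lt_of_le_of_lt ?_ hk₀
  rw [one_div, inv_pow]
  exact inv_anti₀ (by positivity) (pow_le_pow_right₀ (by norm_num) (by omega))

lemma norm_mem_of_fourierS_wavePacket_ne_zero {d : ℕ} {g : 𝓢(RD d, ℂ)}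
    (hg : ∀ ξ, fourierS g ξ ≠ 0 → ‖ξ‖ ≤ 1 / 20) {ζ : RD d} (hζ : 1 / 2 ≤ ‖ζ‖ ∧ ‖ζ‖ ≤ 2)
    {k : ℕ} {v ξ : RD d} (h : fourierS (wavePacket g v ((2:ℝ)^k • ζ)) ξ ≠ 0) :
    2 ^ k / 2 - 1 / 20 ≤ ‖ξ‖ ∧ ‖ξ‖ ≤ 2 ^ k * 2 + 1 / 20 := by
  rw [fourierS_wavePacket] at h
  have h1 := hg _ (right_ne_zero_of_mul h)
  have hk : (0:ℝ) < 2 ^ k := by positivity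
  have h2 : ‖(2:ℝ)^k • ζ‖ = 2 ^ k * ‖ζ‖ := by rw [norm_smul, norm_pow, Real.norm_ofNat]
  have h3 := norm_sub_norm_le ξ ((2:ℝ)^k • ζ)
  have h4 := norm_sub_norm_le ((2:ℝ)^k • ζ) ξ
  rw [norm_sub_rev] at h4
  have h5 := mul_le_mul_of_nonneg_left hζ.1 hk.le
  have h6 := mul_le_mul_of_nonneg_left hζ.2 hk.le
  constructor <;> linarith

lemma LP_wavePacket_eq_zero {d : ℕ} (D : LPData d) {g : 𝓢(RD d, ℂ)}
    (hg : ∀ ξ, fourierS g ξ ≠ 0 → ‖ξ‖ ≤ 1 / 20) {ζ : RD d} (hζ : 1 / 2 ≤ ‖ζ‖ ∧ ‖ζ‖ ≤ 2)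
    {j k : ℕ} (h : j + 5 ≤ k ∨ k + 5 ≤ j) (v x : RD d) :
    LP D j (wavePacket g v ((2:ℝ)^k • ζ)) x = 0 := by
  refine LP_eq_zero D j _ (fun ξ hξ => ?_) x
  have hn := norm_mem_of_fourierS_wavePacket_ne_zero hg hζ hξ
  rcases h with h | h
  · refine LPhat_eq_zero_of_lt_norm D j ?_
    have h1 : (2:ℝ) ^ (j + 1 + 4) ≤ 2 ^ k := pow_le_pow_right₀ (by norm_num) (by omega)
    have h2 : (1:ℝ) ≤ 2 ^ (j + 1) := one_le_pow₀ (by norm_num)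
    rw [pow_add _ _ 4] at h1
    linarith
  · obtain ⟨j, rfl⟩ : ∃ i, j = i + 1 := ⟨j - 1, by omega⟩
    refine LPhat_succ_eq_zero_of_norm_lt D j ?_
    have h1 : (2:ℝ) ^ (k + 4) ≤ 2 ^ j := pow_le_pow_right₀ (by norm_num) (by omega)
    have h2 : (1:ℝ) ≤ 2 ^ k := one_le_pow₀ (by norm_num)
    rw [pow_add] at h1
    linarith

section

variable {d : ℕ} {m : ℝ} {e : RD d} {ψ : RD d → ℝ}

lemma exists_mul_BesovNorm_lt_of_one_lt_of_one_lt (hd : 1 ≤ d) (D : LPData d) (he : ‖e‖ = 1)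
    (hone : ∀ ξ, ‖ξ - e‖ ≤ 1 / 20 → ψ ξ = 1)
    (hs : ∀ ξ, ψ ξ ≠ 0 → 9 / 10 ≤ ‖ξ‖ ∧ ‖ξ‖ ≤ 11 / 10) {p q : ℝ≥0∞} (hp : 1 < p)
    (hq : 1 < q) {s : ℝ} (hs0 : s ≤ 0) (C : ℝ≥0) :
    ∃ f : 𝓢(RD d, ℂ), (C : ℝ≥0∞) * BesovNorm D (s + m) p q (⇑f) <
      BesovNorm D s p q (pdo (shiftSymbol m e ψ) f) := by
  have hp0 : 0 < p := zero_lt_one.trans hp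
  obtain ⟨g, -, hg0, hg⟩ := exists_fourierS_bump d
  obtain ⟨c, hc, hgc⟩ := exists_norm_le_decay g (d + 1)
  obtain ⟨X, hX, hXn⟩ := exists_lpNormFun_sum_translate_le hd hp he
  have hWX : lpNormFun d p (fun x => ((c * ((1 + ‖x‖) ^ (d + 1))⁻¹ : ℝ) : ℂ)) ≤
      ENNReal.ofReal c * X := by
    have h := hXn 1
    simp only [Finset.sum_range_one, Nat.cast_zero, zero_smul, sub_zero, Nat.cast_one,
      ENNReal.one_rpow, one_mul] at h
    simp only [Complex.ofReal_mul c]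
    rw [lpNormFun_const_mul hp0 _ hc]
    gcongr
  refine exists_mul_BesovNorm_lt_of_low_frequency D he hone hs hp0 hq s 0 (d + 1) (fun _ => g)
    (fun _ x => c * ((1 + ‖x‖) ^ (d + 1))⁻¹) (B := ENNReal.ofReal c * X)
    (ENNReal.mul_ne_top ENNReal.ofReal_ne_top hX) g
    (lpNormFun_pos hp0 g.continuous hg).ne' (fun k ξ hξ => ?_) (fun _ => hgc) (fun k x y => ?_)
    (fun k => ?_) (fun k _ x => ?_) C
  · have h1 : (1:ℝ) ≤ 2 ^ k := one_le_pow₀ (by norm_num)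
    linarith [hg0 ξ hξ]
  · rw [mul_assoc]
    exact mul_le_mul_of_nonneg_left
      (decay_slowly_varying (d + 1) (one_le_pow₀ (by norm_num)) x y) hc.le
  · refine le_trans (mul_le_of_le_one_left zero_le (ENNReal.ofReal_le_one.2 ?_)) hWX
    exact Real.rpow_le_one_of_one_le_of_nonpos (one_le_pow₀ (by norm_num)) hs0
  · refine LP_eq_self D 0 g (fun ξ hξ => LPhat_zero_eq_one D ?_) x
    linarith [hg0 ξ hξ]

lemma exists_mul_BesovNorm_lt_of_one_lt_of_le_one (hd : 1 ≤ d) (D : LPData d) (he : ‖e‖ = 1)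
    (hone : ∀ ξ, ‖ξ - e‖ ≤ 1 / 20 → ψ ξ = 1)
    (hs : ∀ ξ, ψ ξ ≠ 0 → 9 / 10 ≤ ‖ξ‖ ∧ ‖ξ‖ ≤ 11 / 10) {p q : ℝ≥0∞} (hp : 1 < p)
    (hq : 0 < q) (hq1 : q ≤ 1) {s : ℝ} (hs0 : s ≤ 0) (C : ℝ≥0) :
    ∃ f : 𝓢(RD d, ℂ), (C : ℝ≥0∞) * BesovNorm D (s + m) p q (⇑f) <
      BesovNorm D s p q (pdo (shiftSymbol m e ψ) f) := by
  have hp0 : 0 < p := zero_lt_one.trans hp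
  have hqt : q ≠ ⊤ := ne_top_of_le_ne_top ENNReal.one_ne_top hq1
  have hq0 : 0 < q.toReal := ENNReal.toReal_pos hq.ne' hqt
  have hθ : 1 / p.toReal < 1 / q.toReal := by
    have h1 : 1 ≤ 1 / q.toReal := by
      rw [le_div_iff₀ hq0, one_mul, ← ENNReal.toReal_one]
      exact ENNReal.toReal_mono ENNReal.one_ne_top hq1
    refine lt_of_lt_of_le ?_ h1
    rcases eq_or_ne p ⊤ with rfl | hpt
    · simp
    · have h2 : 1 < p.toReal := by
        rw [← ENNReal.toReal_one]
        exact (ENNReal.toReal_lt_toReal ENNReal.one_ne_top hpt).2 hp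
      rw [div_lt_one (by linarith)]
      exact h2
  obtain ⟨g, -, hg0, hg⟩ := exists_fourierS_bump d
  obtain ⟨c, hc, hgc⟩ := exists_norm_le_decay g (d + 1)
  obtain ⟨X, hX, hXn⟩ := exists_lpNormFun_sum_translate_le hd hp he
  obtain ⟨ζ, hζ⟩ := exists_fourierS_φ_ne_zero hd D
  have hζn := D.supp_φ ζ hζ
  obtain ⟨c₁, hc₁, δ, hδ, k₀, hlow⟩ := exists_le_norm_LP_wavePacket D hg hζ
  set κ : ℕ → ℕ := fun i => k₀ + 5 * i with hκ
  set F : ℕ → 𝓢(RD d, ℂ) := fun i => wavePacket g ((i:ℝ) • e) ((2:ℝ)^(κ i + 1) • ζ) with hF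
  set G : ℕ → 𝓢(RD d, ℂ) := fun n => ∑ i ∈ Finset.range n, F i with hG
  set H : ℕ → RD d → ℝ := fun n x =>
    c * ∑ i ∈ Finset.range n, ((1 + ‖x - (i:ℝ) • e‖) ^ (d + 1))⁻¹ with hH
  set M : ℕ → ℕ := fun n => k₀ + 5 * n + 10 with hM
  refine exists_mul_BesovNorm_lt_of_many_blocks D he hone hs hp0 hq hqt s (d + 1)
    (by positivity : 0 ≤ 1 / p.toReal) hθ M (fun n => (Finset.range n).image κ) G H
    (fun n => ((2:ℝ) ^ M n) ^ s) (X := ENNReal.ofReal c * X)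
    (b := ENNReal.ofReal c₁ * volume (Metric.ball (0 : RD d) δ) ^ (1 / p.toReal))
    (ENNReal.mul_ne_top ENNReal.ofReal_ne_top hX) ?_ (fun n => by positivity)
    (fun n => by simp only [hM]; omega) (fun n => ?_) (fun n ξ hξ => ?_) (fun n x => ?_)
    (fun n x y => ?_) (fun n _ => ?_) (fun n j hj => ?_) C
  · exact mul_ne_zero (by simpa using hc₁) (volume_ball_rpow_pos hδ).ne'
  · rw [Finset.card_image_of_injective _ fun a b hab => ?_, Finset.card_range]
    simpa [hκ] using hab
  · rw [hG, fourierS_sum] at hξ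
    obtain ⟨i, hi, hne⟩ := Finset.exists_ne_zero_of_sum_ne_zero hξ
    have h1 := (norm_mem_of_fourierS_wavePacket_ne_zero hg0 hζn hne).2
    have hi' := Finset.mem_range.1 hi
    have h2 : (2:ℝ) ^ (κ i + 1 + 6) ≤ 2 ^ M n :=
      pow_le_pow_right₀ (by norm_num) (by simp only [hκ, hM]; omega)
    have h3 : (1:ℝ) ≤ 2 ^ (κ i + 1) := one_le_pow₀ (by norm_num)
    rw [pow_add _ _ 6] at h2
    linarith
  · simp only [hG, hH, _root_.sum_apply, Finset.mul_sum]
    refine (norm_sum_le _ _).trans (Finset.sum_le_sum fun i _ => ?_)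
    rw [norm_wavePacket_apply]
    exact hgc _
  · simp only [hH]
    rw [mul_assoc, Finset.sum_mul]
    refine mul_le_mul_of_nonneg_left (Finset.sum_le_sum fun i _ => ?_) hc.le
    rw [sub_right_comm]
    exact decay_slowly_varying (d + 1) (one_le_pow₀ (by norm_num)) _ _
  · simp only [hH, Complex.ofReal_mul c]
    rw [lpNormFun_const_mul hp0 _ hc]
    refine mul_le_mul' le_rfl ?_
    calc _ ≤ ENNReal.ofReal c * ((n : ℝ≥0∞) ^ (1 / p.toReal) * X) := mul_le_mul' le_rfl (hXn n)
      _ = _ := by ring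
  · obtain ⟨i, hi, rfl⟩ := Finset.mem_image.1 hj
    have hi' := Finset.mem_range.1 hi
    have hblock : ∀ x, LP D (κ i + 1) (G n) x = LP D (κ i + 1) (F i) x := fun x => by
      rw [hG]
      simp only
      rw [LP_sum, Finset.sum_eq_single i]
      · intro l _ hli
        refine LP_wavePacket_eq_zero D hg0 hζn ?_ _ _
        simp only [hκ]
        omega
      · exact fun h => absurd hi h
    rw [ENNReal_two_rpow]
    gcongr ?_ * ?_
    · refine ENNReal.ofReal_le_ofReal ?_
      rw [← Real.rpow_natCast, ← Real.rpow_mul (by norm_num), mul_comm]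
      refine Real.rpow_le_rpow_of_exponent_le (by norm_num) (mul_le_mul_of_nonpos_left ?_ hs0)
      have h : κ i + 1 ≤ M n := by simp only [hκ, hM]; omega
      exact_mod_cast h
    · refine le_lpNormFun_of_ball hp0 hδ ((i:ℝ) • e) fun x hx => ?_
      rw [hblock]
      exact hlow (κ i) (by simp only [hκ]; omega) _ x hx

end

/-- if `s ≤ τ_p = d/min(1,p) - d` then some `a ∈ S^m_{1,1}` is unbounded
from `B_p^{s+m,q}` to `B_p^{s,q}`. -/
theorem statement5 (d : ℕ) (hd : 1 ≤ d) (m : ℝ) (p q : ℝ≥0∞)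
    (hp : 0 < p) (hq : 0 < q)
    (s : ℝ) (hs : s ≤ (d : ℝ) / (min 1 p).toReal - d)
    (D : LPData d) :
    ∃ a : RD d → RD d → ℂ, IsSymbolS11 d m a ∧
      ∀ C : ℝ≥0, 0 < C → ∃ f : 𝓢(RD d, ℂ),
        (C : ℝ≥0∞) * BesovNorm D (s+m) p q (⇑f) < BesovNorm D s p q (pdo a f) := by
  set e : RD d := EuclideanSpace.single ⟨0, hd⟩ 1
  have he : ‖e‖ = 1 := by simp [e]
  let ψ : ContDiffBump e := ⟨1 / 20, 1 / 10, by norm_num, by norm_num⟩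
  have hone : ∀ ξ, ‖ξ - e‖ ≤ 1 / 20 → ψ ξ = 1 := fun ξ hξ =>
    ψ.one_of_mem_closedBall (mem_closedBall_iff_norm.2 hξ)
  have hsupp : ∀ ξ, ψ ξ ≠ 0 → 9 / 10 ≤ ‖ξ‖ ∧ ‖ξ‖ ≤ 11 / 10 := fun ξ hξ => by
    have h : ξ ∈ Function.support ψ := hξ
    rw [ψ.support_eq] at h
    have h1 : ‖ξ - e‖ < 1 / 10 := mem_ball_iff_norm.1 h
    have h2 := norm_sub_norm_le ξ e
    have h3 := norm_sub_norm_le e ξ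
    rw [norm_sub_rev] at h3
    constructor <;> linarith
  refine ⟨shiftSymbol m e ψ, isSymbolS11_shiftSymbol ψ.contDiff ψ.hasCompactSupport hsupp,
    fun C _ => ?_⟩
  rcases le_or_gt p 1 with hp1 | hp1
  · rw [min_eq_right hp1] at hs
    exact exists_mul_BesovNorm_lt_of_le_one hd D he hone hsupp hp hp1 hq hs C
  · have hs0 : s ≤ 0 := by simpa [min_eq_left hp1.le] using hs
    rcases le_or_gt q 1 with hq1 | hq1
    · exact exists_mul_BesovNorm_lt_of_one_lt_of_le_one hd D he hone hsupp hp1 hq hq1 hs0 C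
    · exact exists_mul_BesovNorm_lt_of_one_lt_of_one_lt hd D he hone hsupp hp1 hq1 hs0 C

end
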